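/- arXiv:2512.12988 — 3 statements merged into one kernel-verified Lean document; each statement's English description precedes it below -/
import Mathlib

section
/- Let K ≥ 1 and let I_1, …, I_K be pairwise disjoint compact intervals I_k = [c_k − r_k, c_k + r_k] (c_k ∈ ℝ, r_k > 0) with c_k + r_k < c_{k+1} − r_{k+1} for 1 ≤ k ≤ K−1. Suppose σ, σ' > 0, (w_1,…,w_K) and (w'_1,…,w'_K) are probability vectors with all entries strictly positive, and V_k, V'_k are Borel probability measures on ℝ with supp(V_k) ⊆ I_k and supp(V'_k) ⊆ I_k for every k. If Σ_{k=1}^K w_k ∫ g_{u,σ}(x) dV_k(u) = Σ_{k=1}^K w'_k ∫ g_{u,σ'}(x) dV'_k(u) for every x ∈ ℝ, then σ = σ', w_k = w'_k, and V_k = V'_k (hence the component densities f_k = ∫ g_{u,σ} dV_k agree) for every k = 1, …, K. -/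
open MeasureTheory

/-- The normal density on ℝ with mean `u` and standard deviation `σ`. -/
noncomputable def gaussD (u σ x : ℝ) : ℝ :=
  (1 / (Real.sqrt (2 * Real.pi) * σ)) * Real.exp (-(x - u) ^ 2 / (2 * σ ^ 2))


open MeasureTheory ProbabilityTheory Filter Topology in
lemma gaussD_meas (σ x : ℝ) : Measurable (fun u => gaussD u σ x) := by
  unfold gaussD
  fun_prop

lemma gaussD_nonneg (u x : ℝ) {σ : ℝ} (hσ : 0 < σ) : 0 ≤ gaussD u σ x := by
  unfold gaussD
  positivity

lemma gaussD_bound (u x : ℝ) {σ : ℝ} (hσ : 0 < σ) :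
    gaussD u σ x ≤ 1 / (Real.sqrt (2 * Real.pi) * σ) := by
  unfold gaussD
  have h : Real.exp (-(x - u) ^ 2 / (2 * σ ^ 2)) ≤ 1 := by
    rw [Real.exp_le_one_iff]
    apply div_nonpos_of_nonpos_of_nonneg
    · nlinarith [sq_nonneg (x - u)]
    · positivity
  exact mul_le_of_le_one_right (by positivity) h

lemma gaussD_integrable (μ : Measure ℝ) [IsFiniteMeasure μ] (x : ℝ) {σ : ℝ} (hσ : 0 < σ) :
    Integrable (fun u => gaussD u σ x) μ := by
  refine Integrable.of_bound (gaussD_meas σ x).aestronglyMeasurable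
    (1 / (Real.sqrt (2 * Real.pi) * σ)) (ae_of_all _ fun u => ?_)
  rw [Real.norm_of_nonneg (gaussD_nonneg u x hσ)]
  exact gaussD_bound u x hσ

open Filter Topology in
lemma sigma_le (μ μ' : Measure ℝ) [IsProbabilityMeasure μ] [IsProbabilityMeasure μ']
    (M : ℝ) (hμ : ∀ᵐ u ∂μ, |u| ≤ M) (hμ' : ∀ᵐ u ∂μ', |u| ≤ M)
    {σ σ' : ℝ} (hσ : 0 < σ) (hσ' : 0 < σ')
    (h : ∀ x, ∫ u, gaussD u σ x ∂μ = ∫ u, gaussD u σ' x ∂μ') : σ' ≤ σ := by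
  by_contra hlt
  push Not at hlt
  set A := 1 / (Real.sqrt (2 * Real.pi) * σ) with hA
  set B := 1 / (Real.sqrt (2 * Real.pi) * σ') with hB
  have hApos : 0 < A := by positivity
  have hBpos : 0 < B := by positivity
  set a := 1 / (2 * σ ^ 2) with ha
  set b := 1 / (2 * σ' ^ 2) with hb
  have hb0 : 0 < b := by positivity
  have hab : b < a := by
    rw [ha, hb]
    apply one_div_lt_one_div_of_lt (by positivity)
    nlinarith
  have key : ∀ x, M ≤ x → 0 ≤ M →
      B ≤ A * Real.exp (x * ((b - a) * x + 2 * M * (a + b)) + (b - a) * M ^ 2) := by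
    intro x hx hM
    have h1 : ∫ u, gaussD u σ x ∂μ ≤ A * Real.exp (-(a * (x - M) ^ 2)) := by
      have := integral_mono_ae (gaussD_integrable μ x hσ)
        (integrable_const (A * Real.exp (-(a * (x - M) ^ 2)))) (by
          filter_upwards [hμ] with u hu
          have hu' := abs_le.1 hu
          unfold gaussD
          rw [← hA]
          apply mul_le_mul_of_nonneg_left _ hApos.le
          rw [Real.exp_le_exp]
          have : -(x - u) ^ 2 / (2 * σ ^ 2) = -(a * (x - u) ^ 2) := by
            rw [ha]; ring
          rw [this, neg_le_neg_iff]
          apply mul_le_mul_of_nonneg_left _ (hb0.trans hab).le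
          apply pow_le_pow_left₀ <;> linarith [hu'.1, hu'.2])
      simpa using this
    have h2 : B * Real.exp (-(b * (x + M) ^ 2)) ≤ ∫ u, gaussD u σ' x ∂μ' := by
      have := integral_mono_ae 
        (integrable_const (B * Real.exp (-(b * (x + M) ^ 2)))) (gaussD_integrable μ' x hσ') (by
          filter_upwards [hμ'] with u hu
          have hu' := abs_le.1 hu
          unfold gaussD
          rw [← hB]
          apply mul_le_mul_of_nonneg_left _ hBpos.le
          rw [Real.exp_le_exp]
          have : -(x - u) ^ 2 / (2 * σ' ^ 2) = -(b * (x - u) ^ 2) := by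
            rw [hb]; ring
          rw [this, neg_le_neg_iff]
          apply mul_le_mul_of_nonneg_left _ hb0.le
          apply pow_le_pow_left₀ <;> linarith [hu'.1, hu'.2])
      simpa using this
    have h3 := h2.trans ((h x).symm.le.trans h1)
    have h4 := mul_le_mul_of_nonneg_right h3 (Real.exp_pos (b * (x + M) ^ 2)).le
    rw [mul_assoc, mul_assoc, ← Real.exp_add, ← Real.exp_add, neg_add_cancel, Real.exp_zero,
      mul_one] at h4
    have h5 : x * ((b - a) * x + 2 * M * (a + b)) + (b - a) * M ^ 2 =
        -(a * (x - M) ^ 2) + b * (x + M) ^ 2 := by ring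
    rw [h5]
    exact h4
  have hM : 0 ≤ M := by
    obtain ⟨u, hu⟩ := hμ.exists
    exact (abs_nonneg u).trans hu
  have t1 : Tendsto (fun x : ℝ => (b - a) * x + 2 * M * (a + b)) atTop atBot :=
    tendsto_atBot_add_const_right _ _ (tendsto_id.const_mul_atTop_of_neg (by linarith))
  have t2 : Tendsto (fun x : ℝ => x * ((b - a) * x + 2 * M * (a + b)) + (b - a) * M ^ 2)
      atTop atBot :=
    tendsto_atBot_add_const_right _ _ (tendsto_id.atTop_mul_atBot₀ t1)
  have t3 := (Real.tendsto_exp_atBot.comp t2).const_mul A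
  rw [mul_zero] at t3
  have := ge_of_tendsto t3 ((eventually_ge_atTop M).mono fun x hx => key x hx hM)
  linarith

open ProbabilityTheory in
lemma meas_eq (μ μ' : Measure ℝ) [IsProbabilityMeasure μ] [IsProbabilityMeasure μ']
    (M : ℝ) (hμ : ∀ᵐ u ∂μ, |u| ≤ M) (hμ' : ∀ᵐ u ∂μ', |u| ≤ M)
    {σ : ℝ} (hσ : 0 < σ)
    (h : ∀ x, ∫ u, gaussD u σ x ∂μ = ∫ u, gaussD u σ x ∂μ') : μ = μ' := by
  set f : ℝ → ENNReal := fun u => ENNReal.ofReal (Real.exp (-u ^ 2 / (2 * σ ^ 2))) with hf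
  have hfm : Measurable f := by fun_prop
  have hf0 : ∀ u, f u ≠ 0 := fun u => by simp [hf, Real.exp_pos]
  have hft : ∀ u, f u ≠ ⊤ := fun u => by simp [hf]
  have hf1 : ∀ u, f u ≤ 1 := fun u => by
    rw [hf, ENNReal.ofReal_le_one, Real.exp_le_one_iff]
    apply div_nonpos_of_nonpos_of_nonneg
    · nlinarith [sq_nonneg u]
    · positivity
  have hfin : ∀ ν : Measure ℝ, IsProbabilityMeasure ν → IsFiniteMeasure (ν.withDensity f) := by
    intro ν hν
    apply isFiniteMeasure_withDensity
    refine ((lintegral_mono hf1).trans_lt ?_).ne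
    simp
  have hν := hfin μ inferInstance
  have hν' := hfin μ' inferInstance
  have inv : ∀ ν : Measure ℝ, (ν.withDensity f).withDensity (fun u => (f u)⁻¹) = ν := fun ν =>
    withDensity_inv_same hfm (ae_of_all _ hf0) (ae_of_all _ hft)
  have nz : ∀ ν : Measure ℝ, IsProbabilityMeasure ν → ν.withDensity f ≠ 0 := by
    intro ν hν h0
    have := inv ν
    rw [h0, withDensity_zero_left] at this
    exact IsProbabilityMeasure.ne_zero ν this.symm
  have hm : ∀ ν : Measure ℝ, ∀ t : ℝ, mgf id (ν.withDensity f) t =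
      (Real.sqrt (2 * Real.pi) * σ) * Real.exp ((t * σ ^ 2) ^ 2 / (2 * σ ^ 2)) *
        ∫ u, gaussD u σ (t * σ ^ 2) ∂ν := by
    intro ν t
    rw [mgf, integral_withDensity_eq_integral_toReal_smul hfm
      (ae_of_all _ fun u => (hft u).lt_top), ← integral_const_mul]
    congr 1
    ext u
    have hs : Real.sqrt (2 * Real.pi) ≠ 0 := by positivity
    rw [hf, ENNReal.toReal_ofReal (Real.exp_pos _).le, smul_eq_mul, ← Real.exp_add, gaussD]
    have e : ∀ C E F : ℝ, C ≠ 0 → C * E * (1 / C * F) = E * F := by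
      intro C E F hC
      field_simp
    rw [e _ _ _ (by positivity), ← Real.exp_add]
    congr 1
    simp only [id]
    field_simp
    ring
  have hmgf : mgf id (μ.withDensity f) = mgf id (μ'.withDensity f) := by
    ext t
    rw [hm, hm, h]
  have hset : integrableExpSet id (μ.withDensity f) = Set.univ := by
    rw [Set.eq_univ_iff_forall]
    intro t
    change Integrable _ _
    refine Integrable.of_bound (by fun_prop) (Real.exp (|t| * M)) ?_
    filter_upwards [(withDensity_absolutelyContinuous μ f).ae_le hμ] with u hu
    rw [Real.norm_of_nonneg (Real.exp_pos _).le, Real.exp_le_exp]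
    calc t * u ≤ |t * u| := le_abs_self _
      _ = |t| * |u| := abs_mul _ _
      _ ≤ _ := mul_le_mul_of_nonneg_left hu (abs_nonneg t)
  have heqon := eqOn_complexMGF_of_mgf' hmgf
    (iff_of_false (nz μ inferInstance) (nz μ' inferInstance))
  have : μ.withDensity f = μ'.withDensity f := by
    apply Measure.ext_of_complexMGF_id_eq
    ext z
    apply heqon
    simp [hset]
  rw [← inv μ, ← inv μ', this]

open ProbabilityTheory in
lemma mix_prob {K : ℕ} (w : Fin K → ℝ) (hw : ∀ k, 0 < w k) (hws : ∑ k, w k = 1)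
    (V : Fin K → Measure ℝ) (hV : ∀ k, IsProbabilityMeasure (V k)) :
    IsProbabilityMeasure (∑ k, ENNReal.ofReal (w k) • V k) := by
  constructor
  simp only [Measure.coe_finset_sum, Finset.sum_apply, Measure.smul_apply, measure_univ,
    smul_eq_mul, mul_one]
  rw [← ENNReal.ofReal_sum_of_nonneg (fun k _ => (hw k).le), hws, ENNReal.ofReal_one]

lemma mix_integral {K : ℕ} (w : Fin K → ℝ) (hw : ∀ k, 0 < w k)
    (V : Fin K → Measure ℝ) (hV : ∀ k, IsProbabilityMeasure (V k)) {σ : ℝ} (hσ : 0 < σ) (x : ℝ) :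
    ∫ u, gaussD u σ x ∂(∑ k, ENNReal.ofReal (w k) • V k) =
      ∑ k, w k * ∫ u, gaussD u σ x ∂(V k) := by
  rw [integral_finsetSum_measure]
  · refine Finset.sum_congr rfl fun k _ => ?_
    rw [integral_smul_measure, ENNReal.toReal_ofReal (hw k).le, smul_eq_mul]
  · intro k _
    exact (gaussD_integrable (V k) x hσ).smul_measure ENNReal.ofReal_ne_top

lemma mix_restrict {K : ℕ} (w : Fin K → ℝ)
    (V : Fin K → Measure ℝ) (I : Fin K → Set ℝ) (hI : ∀ k, MeasurableSet (I k))
    (hd : ∀ j k, j ≠ k → Disjoint (I j) (I k)) (hs : ∀ k, V k (I k)ᶜ = 0) (k : Fin K) :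
    (∑ k, ENNReal.ofReal (w k) • V k).restrict (I k) = ENNReal.ofReal (w k) • V k := by
  ext s hs'
  rw [Measure.restrict_apply hs']
  simp only [Measure.coe_finset_sum, Finset.sum_apply, Measure.smul_apply, smul_eq_mul]
  rw [Finset.sum_eq_single k]
  · rw [measure_inter_conull (hs k)]
  · intro j _ hj
    rw [measure_mono_null _ (hs j), mul_zero]
    intro u hu hu'
    exact Set.disjoint_left.1 (hd j k hj) hu' hu.2
  · simp

/-- Identifiability of a finite mixture of location mixtures of normals
whose mixing measures are supported in pairwise disjoint compact intervals
`I_k = [c_k − r_k, c_k + r_k]` ordered so that `c_k + r_k < c_{k+1} − r_{k+1}`. -/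
theorem stmt1 (K : ℕ) (hK : 1 ≤ K) (c r : Fin K → ℝ) (hr : ∀ k, 0 < r k)
    (hord : ∀ k : Fin K, ∀ h : k.val + 1 < K,
      c k + r k < c ⟨k.val + 1, h⟩ - r ⟨k.val + 1, h⟩)
    (σ σ' : ℝ) (hσ : 0 < σ) (hσ' : 0 < σ')
    (w w' : Fin K → ℝ) (hw : ∀ k, 0 < w k) (hw' : ∀ k, 0 < w' k)
    (hws : ∑ k, w k = 1) (hws' : ∑ k, w' k = 1)
    (V V' : Fin K → Measure ℝ)
    (hV : ∀ k, IsProbabilityMeasure (V k)) (hV' : ∀ k, IsProbabilityMeasure (V' k))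
    (hsupp : ∀ k, V k (Set.Icc (c k - r k) (c k + r k))ᶜ = 0)
    (hsupp' : ∀ k, V' k (Set.Icc (c k - r k) (c k + r k))ᶜ = 0)
    (heq : ∀ x : ℝ,
      (∑ k, w k * ∫ u, gaussD u σ x ∂(V k)) = ∑ k, w' k * ∫ u, gaussD u σ' x ∂(V' k)) :
    σ = σ' ∧ (∀ k, w k = w' k) ∧ (∀ k, V k = V' k) := by
  classical
  have hlt : ∀ n : ℕ, ∀ j k : Fin K, k.val = j.val + 1 + n → c j + r j < c k - r k := by
    intro n
    induction n with
    | zero =>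
      intro j k hjk
      have h1 : j.val + 1 < K := by have := k.isLt; omega
      have : k = ⟨j.val + 1, h1⟩ := Fin.ext (by simpa using hjk)
      rw [this]
      exact hord j h1
    | succ n ih =>
      intro j k hjk
      have h1 : j.val + 1 + n < K := by have := k.isLt; omega
      have a1 := ih j ⟨j.val + 1 + n, h1⟩ rfl
      have h2 : j.val + 1 + n + 1 < K := by have := k.isLt; omega
      have a2 := hord ⟨j.val + 1 + n, h1⟩ h2
      have : k = ⟨j.val + 1 + n + 1, h2⟩ := Fin.ext (by simp only; omega)
      rw [this]
      have := hr ⟨j.val + 1 + n, h1⟩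
      linarith
  set I : Fin K → Set ℝ := fun k => Set.Icc (c k - r k) (c k + r k) with hI
  have hd : ∀ j k, j ≠ k → Disjoint (I j) (I k) := by
    intro j k hjk
    rw [Set.disjoint_left]
    rintro u ⟨h1, h2⟩ ⟨h3, h4⟩
    rcases lt_or_gt_of_ne (fun h => hjk (Fin.ext h) : j.val ≠ k.val) with h | h
    · have := hlt (k.val - j.val - 1) j k (by omega)
      linarith
    · have := hlt (j.val - k.val - 1) k j (by omega)
      linarith
  have hIm : ∀ k, MeasurableSet (I k) := fun k => measurableSet_Icc
  have P := mix_prob w hw hws V hV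
  have P' := mix_prob w' hw' hws' V' hV'
  set M : ℝ := ∑ k, (|c k| + |r k|) with hM
  have hb : ∀ (w : Fin K → ℝ) (V : Fin K → Measure ℝ), (∀ k, V k (I k)ᶜ = 0) →
      ∀ᵐ u ∂(∑ k, ENNReal.ofReal (w k) • V k), |u| ≤ M := by
    intro w V hs
    rw [ae_iff]
    simp only [Measure.coe_finset_sum, Finset.sum_apply, Measure.smul_apply, smul_eq_mul]
    refine Finset.sum_eq_zero fun k _ => ?_
    rw [measure_mono_null _ (hs k), mul_zero]
    rintro u hu ⟨h1, h2⟩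
    apply hu
    have : |c k| + |r k| ≤ M :=
      Finset.single_le_sum (f := fun k => |c k| + |r k|) (fun i _ => by positivity)
        (Finset.mem_univ k)
    rw [abs_le]
    constructor <;> linarith [neg_abs_le (c k), le_abs_self (c k), le_abs_self (r k)]
  have B := hb w V hsupp
  have B' := hb w' V' hsupp'
  have E : ∀ x, ∫ u, gaussD u σ x ∂(∑ k, ENNReal.ofReal (w k) • V k) =
      ∫ u, gaussD u σ' x ∂(∑ k, ENNReal.ofReal (w' k) • V' k) := by
    intro x
    rw [mix_integral w hw V hV hσ, mix_integral w' hw' V' hV' hσ', heq]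
  have hσσ : σ = σ' := le_antisymm (sigma_le _ _ M B' B hσ' hσ fun x => (E x).symm)
    (sigma_le _ _ M B B' hσ hσ' E)
  subst hσσ
  have hmm := meas_eq _ _ M B B' hσ E
  have hk : ∀ k, ENNReal.ofReal (w k) • V k = ENNReal.ofReal (w' k) • V' k := by
    intro k
    rw [← mix_restrict w V I hIm hd hsupp k, ← mix_restrict w' V' I hIm hd hsupp' k, hmm]
  have hwk : ∀ k, ENNReal.ofReal (w k) = ENNReal.ofReal (w' k) := by
    intro k
    have := congrArg (fun m : Measure ℝ => m Set.univ) (hk k)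
    simpa using this
  refine ⟨rfl, fun k => ?_, fun k => ?_⟩
  · exact (ENNReal.ofReal_eq_ofReal_iff (hw k).le (hw' k).le).1 (hwk k)
  · have h1 := hk k
    rw [← hwk k] at h1
    have hne : ENNReal.ofReal (w k) ≠ 0 := by simpa using hw k
    ext s _
    have := congrArg (fun m : Measure ℝ => m s) h1
    simp only [Measure.smul_apply, smul_eq_mul] at this
    exact (ENNReal.mul_right_inj hne ENNReal.ofReal_ne_top).1 this
end

section
/- Let K ≥ 1 and σ, σ' > 0. Suppose (w_1,…,w_K) and (w'_1,…,w'_K) are probability vectors with all entries strictly positive, and V_1,…,V_K and V'_1,…,V'_K are Borel probability measures on ℝ with compact support such that both families satisfy the separation condition max_{1≤k≤K} d_w(supp(V_k)) < min_{1≤i<j≤K} d_b(supp(V_i), supp(V_j)) (and likewise for the V'_k). If Σ_{k=1}^K w_k ∫ g_{u,σ}(x) dV_k(u) = Σ_{k=1}^K w'_k ∫ g_{u,σ'}(x) dV'_k(u) for every x ∈ ℝ, then σ = σ' and there is a permutation τ of {1,…,K} with w'_k = w_{τ(k)} and V'_k = V_{τ(k)} for every k. -/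
open MeasureTheory

/-- Topological support of a Borel measure on ℝ: the set of points all of whose
neighbourhoods have positive measure. -/
def msupport (μ : Measure ℝ) : Set ℝ := {x | ∀ U ∈ nhds x, μ U ≠ 0}

/-- The partition of a set `S ⊆ ℝ` into its nonempty connected pieces
(connected components within `S`). -/
def pieces (S : Set ℝ) : Set (Set ℝ) := {T | ∃ x ∈ S, T = connectedComponentIn S x}

/-- Distance between two sets: `d_c(I, J) = inf {|x − y| : x ∈ I, y ∈ J}`. -/
noncomputable def dc (I J : Set ℝ) : ℝ := sInf (Set.image2 (fun x y => |x - y|) I J)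

/-- `I` and `J` are neighbouring pieces of `S`: both are connected pieces of `S`,
distinct, and no third piece `T` satisfies `d_c(I,T) < d_c(I,J)` and `d_c(J,T) < d_c(I,J)`. -/
def isNeighborPair (S I J : Set ℝ) : Prop :=
  I ∈ pieces S ∧ J ∈ pieces S ∧ I ≠ J ∧
    ¬ ∃ T ∈ pieces S, T ≠ I ∧ T ≠ J ∧ dc I T < dc I J ∧ dc J T < dc I J

open Classical in
/-- The within-space distance `d_w(S)`: `0` if `S` is connected, otherwise the supremum
of `d_c(I, J)` over neighbouring pairs of pieces of `S`. -/
noncomputable def dw (S : Set ℝ) : ℝ :=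
  if IsPreconnected S then 0
  else sSup {d | ∃ I J : Set ℝ, isNeighborPair S I J ∧ d = dc I J}

/-- The between-space distance `d_b(S, T)`: the infimum of `d_c(I, J)` over pieces
`I` of `S` and `J` of `T`. -/
noncomputable def db (S T : Set ℝ) : ℝ :=
  sInf {d | ∃ I ∈ pieces S, ∃ J ∈ pieces T, d = dc I J}


lemma dc_le {I J : Set ℝ} {x y : ℝ} (hx : x ∈ I) (hy : y ∈ J) : dc I J ≤ |x - y| :=
  csInf_le ⟨0, by rintro _ ⟨a, _, b, _, rfl⟩; exact abs_nonneg _⟩ ⟨x, hx, y, hy, rfl⟩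

lemma le_dc {I J : Set ℝ} {r : ℝ} (hI : I.Nonempty) (hJ : J.Nonempty)
    (h : ∀ x ∈ I, ∀ y ∈ J, r ≤ |x - y|) : r ≤ dc I J :=
  le_csInf (hI.image2 hJ) (by rintro _ ⟨a, ha, b, hb, rfl⟩; exact h a ha b hb)

lemma dc_nonneg (I J : Set ℝ) : 0 ≤ dc I J :=
  Real.sInf_nonneg (by rintro _ ⟨a, _, b, _, rfl⟩; exact abs_nonneg _)

lemma dw_nonneg (S : Set ℝ) : 0 ≤ dw S := by
  unfold dw
  split_ifs
  · exact le_rfl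
  · exact Real.sSup_nonneg (by rintro _ ⟨I, J, _, rfl⟩; exact dc_nonneg _ _)

lemma db_le {S T : Set ℝ} {x y : ℝ} (hx : x ∈ S) (hy : y ∈ T) : db S T ≤ |x - y| := by
  refine le_trans (csInf_le ⟨0, ?_⟩ ⟨_, ⟨x, hx, rfl⟩, _, ⟨y, hy, rfl⟩, rfl⟩)
    (dc_le (mem_connectedComponentIn hx) (mem_connectedComponentIn hy))
  rintro _ ⟨I, _, J, _, rfl⟩
  exact dc_nonneg _ _

lemma precon_sub {A B T : Set ℝ} (hA : IsCompact A) (hB : IsCompact B) (hd : Disjoint A B)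
    (hT : IsPreconnected T) (hTS : T ⊆ A ∪ B) {x : ℝ} (hxT : x ∈ T) (hxA : x ∈ A) : T ⊆ A := by
  intro y hy
  by_contra hyA
  have hyB : y ∈ B := (hTS hy).resolve_left hyA
  obtain ⟨z, _, hzA, hzB⟩ := isPreconnected_closed_iff.1 hT A B hA.isClosed hB.isClosed hTS
    ⟨x, hxT, hxA⟩ ⟨y, hy, hyB⟩
  exact Set.disjoint_left.1 hd hzA hzB

lemma split_dw {A B : Set ℝ} (hA : IsCompact A) (hB : IsCompact B) (hd : Disjoint A B)
    (hAn : A.Nonempty) (hBn : B.Nonempty) : ∃ a ∈ A, ∃ b ∈ B, |a - b| ≤ dw (A ∪ B) := by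
  obtain ⟨⟨a, b⟩, ⟨ha, hb⟩, hmin⟩ := (hA.prod hB).exists_isMinOn (hAn.prod hBn)
    (f := fun p : ℝ × ℝ => |p.1 - p.2|) (by fun_prop)
  simp only at ha hb
  have hmin' : ∀ x ∈ A, ∀ y ∈ B, |a - b| ≤ |x - y| := fun x hx y hy => hmin (a := (x, y)) ⟨hx, hy⟩
  refine ⟨a, ha, b, hb, ?_⟩
  have hncon : ¬ IsPreconnected (A ∪ B) := fun h =>
    Set.disjoint_left.1 hd (precon_sub hA hB hd h subset_rfl (Or.inl ha) ha (Or.inr hb)) hb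
  have subA : ∀ x ∈ A, connectedComponentIn (A ∪ B) x ⊆ A := fun x hx =>
    precon_sub hA hB hd isPreconnected_connectedComponentIn (connectedComponentIn_subset _ _)
      (mem_connectedComponentIn (Or.inl hx)) hx
  have subB : ∀ x ∈ B, connectedComponentIn (A ∪ B) x ⊆ B := fun x hx =>
    precon_sub hB hA hd.symm isPreconnected_connectedComponentIn
      ((connectedComponentIn_subset _ _).trans (Set.union_comm A B).subset)
      (mem_connectedComponentIn (Or.inr hx)) hx
  set I := connectedComponentIn (A ∪ B) a with hI
  set J := connectedComponentIn (A ∪ B) b with hJ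
  have haI : a ∈ I := mem_connectedComponentIn (Or.inl ha)
  have hbJ : b ∈ J := mem_connectedComponentIn (Or.inr hb)
  have hIJ : dc I J = |a - b| := le_antisymm (dc_le haI hbJ)
    (le_dc ⟨a, haI⟩ ⟨b, hbJ⟩ fun x hx y hy => hmin' x (subA a ha hx) y (subB b hb hy))
  unfold dw
  rw [if_neg hncon, ← hIJ]
  apply le_csSup
  · obtain ⟨C, hC⟩ := ((hA.union hB).prod (hA.union hB)).bddAbove_image
      (f := fun p : ℝ × ℝ => |p.1 - p.2|) (by fun_prop)
    refine ⟨C, ?_⟩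
    rintro _ ⟨_, _, ⟨⟨x, hx, rfl⟩, ⟨y, hy, rfl⟩, _⟩, rfl⟩
    exact (dc_le (mem_connectedComponentIn hx) (mem_connectedComponentIn hy)).trans
      (hC ⟨(x, y), ⟨hx, hy⟩, rfl⟩)
  · refine ⟨I, J, ⟨⟨a, Or.inl ha, rfl⟩, ⟨b, Or.inr hb, rfl⟩, ?_, ?_⟩, rfl⟩
    · intro h
      exact Set.disjoint_left.1 hd (subA a ha (h ▸ hbJ : b ∈ I)) hb
    · rintro ⟨_, ⟨x, hx, rfl⟩, _, _, h1, h2⟩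
      have hxm := mem_connectedComponentIn hx
      rcases hx with hx | hx
      · refine absurd h2 (not_lt.2 (hIJ ▸ le_dc ⟨b, hbJ⟩ ⟨x, hxm⟩ fun p hp q hq => ?_))
        rw [abs_sub_comm p q]
        exact hmin' q (subA x hx hq) p (subB b hb hp)
      · exact absurd h1 (not_lt.2 (hIJ ▸ le_dc ⟨a, haI⟩ ⟨x, hxm⟩ fun p hp q hq =>
          hmin' p (subA a ha hp) q (subB x hx hq)))

/-- refinement step -/
lemma refine_part {K : ℕ} {S S' : Fin K → Set ℝ} (hS : ∀ k, IsCompact (S k))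
    (hS' : ∀ k, IsCompact (S' k)) (hn : ∀ k, (S k).Nonempty) (hn' : ∀ k, (S' k).Nonempty)
    (hU : ⋃ k, S k = ⋃ k, S' k)
    (hcross : ∀ k i j : Fin K, i < j → dw (S k) < db (S' i) (S' j)) :
    ∃ τ : Equiv.Perm (Fin K), ∀ k, S k = S' (τ k) := by
  have hc : ∀ k i j : Fin K, i ≠ j → ∀ x ∈ S' i, ∀ y ∈ S' j, dw (S k) < |x - y| := by
    intro k i j hij x hx y hy
    rcases lt_or_gt_of_ne hij with h | h
    · exact (hcross k i j h).trans_le (db_le hx hy)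
    · rw [abs_sub_comm]; exact (hcross k j i h).trans_le (db_le hy hx)
  have hdis : ∀ i j : Fin K, i ≠ j → Disjoint (S' i) (S' j) := by
    intro i j hij
    rw [Set.disjoint_left]
    intro x hx hx'
    have := hc i i j hij x hx x hx'
    simp only [sub_self, abs_zero] at this
    exact absurd (dw_nonneg (S i)) (not_le.2 this)
  have key : ∀ k, ∃ j, S k ⊆ S' j := by
    intro k
    obtain ⟨x, hx⟩ := hn k
    obtain ⟨j, hj⟩ := Set.mem_iUnion.1 (hU ▸ Set.mem_iUnion.2 ⟨k, hx⟩ : x ∈ ⋃ k, S' k)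
    refine ⟨j, ?_⟩
    by_contra hnot
    obtain ⟨y, hy, hyj⟩ := Set.not_subset.1 hnot
    have hother : ∀ z ∈ S k, z ∉ S' j → ∃ i, i ≠ j ∧ z ∈ S' i := by
      intro z hz hzj
      obtain ⟨i, hi⟩ := Set.mem_iUnion.1 (hU ▸ Set.mem_iUnion.2 ⟨k, hz⟩ : z ∈ ⋃ k, S' k)
      exact ⟨i, fun h => hzj (h ▸ hi), hi⟩
    have hBeq : S k \ S' j = S k ∩ ⋃ i : {i // i ≠ j}, S' i := by
      ext z
      constructor
      · rintro ⟨hz, hzj⟩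
        obtain ⟨i, hij, hi⟩ := hother z hz hzj
        exact ⟨hz, Set.mem_iUnion.2 ⟨⟨i, hij⟩, hi⟩⟩
      · rintro ⟨hz, hz'⟩
        obtain ⟨⟨i, hij⟩, hi⟩ := Set.mem_iUnion.1 hz'
        exact ⟨hz, fun h => Set.disjoint_left.1 (hdis i j hij) hi h⟩
    have hBc : IsCompact (S k \ S' j) := by
      rw [hBeq]
      exact (hS k).inter_right (isCompact_iUnion fun i : {i // i ≠ j} => hS' i).isClosed
    obtain ⟨a, ha, b, hb, hab⟩ := split_dw ((hS k).inter_right (hS' j).isClosed) hBc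
      (Set.disjoint_left.2 fun z hz hz' => hz'.2 hz.2) ⟨x, hx, hj⟩ ⟨y, hy, hyj⟩
    rw [Set.inter_union_sdiff] at hab
    obtain ⟨i, hij, hi⟩ := hother b hb.1 hb.2
    exact absurd (hc k j i hij.symm a ha.2 b hi) (not_lt.2 hab)
  choose f hf using key
  have hsurj : Function.Surjective f := by
    intro j
    obtain ⟨x, hx⟩ := hn' j
    obtain ⟨k, hk⟩ := Set.mem_iUnion.1 (hU ▸ Set.mem_iUnion.2 ⟨j, hx⟩ : x ∈ ⋃ k, S k)
    refine ⟨k, ?_⟩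
    by_contra h
    exact Set.disjoint_left.1 (hdis _ _ h) (hf k hk) hx
  have hbij : Function.Bijective f := Finite.surjective_iff_bijective.1 hsurj
  refine ⟨Equiv.ofBijective f hbij, fun k => ?_⟩
  simp only [Equiv.ofBijective_apply]
  refine Set.Subset.antisymm (hf k) fun x hx => ?_
  obtain ⟨l, hl⟩ := Set.mem_iUnion.1 (hU ▸ Set.mem_iUnion.2 ⟨f k, hx⟩ : x ∈ ⋃ k, S k)
  have : f l = f k := by
    by_contra h
    exact Set.disjoint_left.1 (hdis _ _ h) (hf l hl) hx
  rwa [hbij.1 this] at hl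

lemma part_eq {K : ℕ} {S S' : Fin K → Set ℝ} (hS : ∀ k, IsCompact (S k))
    (hS' : ∀ k, IsCompact (S' k)) (hn : ∀ k, (S k).Nonempty) (hn' : ∀ k, (S' k).Nonempty)
    (hU : ⋃ k, S k = ⋃ k, S' k)
    (hsep : ∀ k i j : Fin K, i < j → dw (S k) < db (S i) (S j))
    (hsep' : ∀ k i j : Fin K, i < j → dw (S' k) < db (S' i) (S' j)) :
    ∃ τ : Equiv.Perm (Fin K), ∀ k, S' k = S (τ k) := by
  by_cases h1 : ∀ k i j : Fin K, i < j → dw (S' k) < db (S i) (S j)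
  · exact refine_part hS' hS hn' hn hU.symm h1
  by_cases h2 : ∀ k i j : Fin K, i < j → dw (S k) < db (S' i) (S' j)
  · obtain ⟨τ, hτ⟩ := refine_part hS hS' hn hn' hU h2
    exact ⟨τ.symm, fun k => by rw [hτ, Equiv.apply_symm_apply]⟩
  push Not at h1 h2
  obtain ⟨k, i, j, hij, h⟩ := h1
  obtain ⟨k', i', j', hij', h'⟩ := h2
  have := hsep k' i j hij
  have := hsep' k i' j' hij'
  linarith

lemma disj_of_sep {K : ℕ} {S : Fin K → Set ℝ}
    (hsep : ∀ k i j : Fin K, i < j → dw (S k) < db (S i) (S j)) (i j : Fin K) (hij : i ≠ j) :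
    Disjoint (S i) (S j) := by
  rw [Set.disjoint_left]
  intro x hx hx'
  have h0 := dw_nonneg (S i)
  rcases lt_or_gt_of_ne hij with h | h
  · have := (hsep i i j h).trans_le (db_le hx hx')
    simp at this; linarith
  · have := (hsep i j i h).trans_le (db_le hx' hx)
    simp at this; linarith

open ProbabilityTheory in
lemma gaussD_eq (u σ x : ℝ) (hσ : 0 < σ) :
    gaussD u σ x = gaussianPDFReal u (Real.toNNReal (σ ^ 2)) x := by
  unfold gaussD gaussianPDFReal
  rw [Real.coe_toNNReal _ (sq_nonneg σ), Real.sqrt_mul (by positivity : 0 ≤ 2 * Real.pi) (σ ^ 2),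
    Real.sqrt_sq hσ.le, one_div]

lemma msupport_compl_null (μ : Measure ℝ) : μ (msupport μ)ᶜ = 0 := by
  refine measure_null_of_locally_null _ fun x hx => ?_
  have : ∃ U ∈ nhds x, μ U = 0 := by
    simpa [msupport] using hx
  obtain ⟨U, hU, h⟩ := this
  exact ⟨U, mem_nhdsWithin_of_mem_nhds hU, h⟩

lemma msupport_nonempty (μ : Measure ℝ) [IsProbabilityMeasure μ] : (msupport μ).Nonempty := by
  by_contra h
  rw [Set.not_nonempty_iff_eq_empty] at h
  have := msupport_compl_null μ
  rw [h] at this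
  simp at this

noncomputable def mixM {K : ℕ} (w : Fin K → ℝ) (V : Fin K → Measure ℝ) : Measure ℝ :=
  ∑ k, ENNReal.ofReal (w k) • V k

lemma mixM_apply {K : ℕ} (w : Fin K → ℝ) (V : Fin K → Measure ℝ) (A : Set ℝ) :
    mixM w V A = ∑ k, ENNReal.ofReal (w k) * V k A := by
  simp [mixM]

lemma mixM_prob {K : ℕ} (w : Fin K → ℝ) (V : Fin K → Measure ℝ) (hw : ∀ k, 0 < w k)
    (hws : ∑ k, w k = 1) (hV : ∀ k, IsProbabilityMeasure (V k)) :
    IsProbabilityMeasure (mixM w V) := by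
  constructor
  rw [mixM_apply]
  simp only [measure_univ, mul_one]
  rw [← ENNReal.ofReal_sum_of_nonneg (fun k _ => (hw k).le), hws, ENNReal.ofReal_one]

lemma mixM_null {K : ℕ} (w : Fin K → ℝ) (V : Fin K → Measure ℝ) (hw : ∀ k, 0 < w k) (A : Set ℝ) :
    mixM w V A = 0 ↔ ∀ k, V k A = 0 := by
  rw [mixM_apply, Finset.sum_eq_zero_iff]
  simp [fun k => not_le.2 (hw k)]

lemma iUnion_msupport {K : ℕ} (w : Fin K → ℝ) (V : Fin K → Measure ℝ) (hw : ∀ k, 0 < w k) :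
    ⋃ k, msupport (V k) = msupport (mixM w V) := by
  ext x
  constructor
  · intro hx U hU h0
    obtain ⟨k, hk⟩ := Set.mem_iUnion.1 hx
    exact hk U hU ((mixM_null w V hw U).1 h0 k)
  · intro hx
    by_contra hnot
    have : ∀ k, ∃ U ∈ nhds x, V k U = 0 := by
      intro k
      by_contra h
      push Not at h
      exact hnot (Set.mem_iUnion.2 ⟨k, h⟩)
    choose U hU h0 using this
    refine hx (⋂ k, U k) (Filter.iInter_mem.2 hU) ((mixM_null w V hw _).2 fun k => ?_)
    exact measure_mono_null (Set.iInter_subset _ k) (h0 k)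

open ProbabilityTheory in
lemma conv_gauss_apply (M : Measure ℝ) [IsProbabilityMeasure M] (v : NNReal)
    {s : Set ℝ} (hs : MeasurableSet s) :
    (M ∗ gaussianReal 0 v) s = ∫⁻ u, gaussianReal u v s ∂M := by
  unfold Measure.conv
  rw [Measure.map_apply (by fun_prop) hs, Measure.prod_apply (measurable_add hs)]
  refine lintegral_congr fun u => ?_
  have := gaussianReal_map_const_add (μ := 0) (v := v) u
  rw [zero_add] at this
  rw [← this, Measure.map_apply (by fun_prop) hs]
  rfl

open ProbabilityTheory in
lemma conv_gauss_eq (M : Measure ℝ) [IsProbabilityMeasure M] {v : NNReal} (hv : v ≠ 0) :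
    M ∗ gaussianReal 0 v = volume.withDensity (fun x => ∫⁻ u, gaussianPDF u v x ∂M) := by
  ext s hs
  rw [conv_gauss_apply M v hs, withDensity_apply _ hs]
  simp_rw [gaussianReal_apply _ hv]
  rw [lintegral_lintegral_swap]
  exact Measurable.aemeasurable (by unfold Function.uncurry; fun_prop)

open ProbabilityTheory in
lemma conv_cancel (M N : Measure ℝ) [IsFiniteMeasure M] [IsFiniteMeasure N] (v : NNReal)
    (h : M ∗ gaussianReal 0 v = N ∗ gaussianReal 0 v) : M = N := by
  refine Measure.ext_of_charFun (funext fun t => ?_)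
  have := congrArg (fun m => charFun m t) h
  simp only [charFun_conv, charFun_gaussianReal] at this
  exact mul_right_cancel₀ (Complex.exp_ne_zero _) this

open ProbabilityTheory in
lemma deconv (M M' : Measure ℝ) [IsProbabilityMeasure M] [IsProbabilityMeasure M']
    (hM' : IsCompact (msupport M')) {v v' : NNReal} (hvv : v' ≤ v)
    (h : M ∗ gaussianReal 0 v = M' ∗ gaussianReal 0 v') : v = v' ∧ M = M' := by
  obtain ⟨c, rfl⟩ := exists_add_of_le hvv
  have hg : gaussianReal 0 (v' + c) = gaussianReal 0 c ∗ gaussianReal 0 v' := by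
    rw [gaussianReal_conv_gaussianReal, add_comm, add_zero]
  rw [hg, ← Measure.conv_assoc] at h
  have h2 := conv_cancel _ _ _ h
  by_cases hc : c = 0
  · subst hc
    simp at h2 ⊢
    exact h2
  · exfalso
    have h3 := msupport_compl_null M'
    rw [← h2, conv_gauss_apply _ _ (by rw [h2]; exact hM'.isClosed.isOpen_compl.measurableSet),
      h2] at h3
    rw [lintegral_eq_zero_iff] at h3
    · obtain ⟨u, hu⟩ := h3.exists
      have : volume (msupport M')ᶜ = 0 := gaussianReal_absolutelyContinuous' u hc hu
      rw [hM'.isClosed.isOpen_compl.measure_eq_zero_iff (volume : Measure ℝ)] at this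
      rw [Set.compl_empty_iff] at this
      exact (noncompact_univ ℝ) (this ▸ hM')
    · have hm := hM'.isClosed.isOpen_compl.measurableSet
      exact (Measure.measurable_coe hm).comp
        (measurable_gaussianReal.comp (measurable_id.prodMk measurable_const))

open ProbabilityTheory in
lemma mix_lintegral {K : ℕ} (w : Fin K → ℝ) (V : Fin K → Measure ℝ) (hw : ∀ k, 0 < w k)
    (hV : ∀ k, IsProbabilityMeasure (V k)) (σ : ℝ) (hσ : 0 < σ) (x : ℝ) :
    ∫⁻ u, gaussianPDF u (Real.toNNReal (σ ^ 2)) x ∂(mixM w V)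
      = ENNReal.ofReal (∑ k, w k * ∫ u, gaussD u σ x ∂(V k)) := by
  have hnn : ∀ u, 0 ≤ gaussD u σ x := fun u => by unfold gaussD; positivity
  rw [ENNReal.ofReal_sum_of_nonneg
    (fun k _ => mul_nonneg (hw k).le (integral_nonneg hnn))]
  unfold mixM
  rw [lintegral_finsetSum_measure]
  refine Finset.sum_congr rfl fun k _ => ?_
  rw [lintegral_smul_measure, ENNReal.ofReal_mul (hw k).le, smul_eq_mul]
  congr 1
  rw [ofReal_integral_eq_lintegral_ofReal _ (Filter.Eventually.of_forall hnn)]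
  · simp only [gaussianPDF, gaussD_eq _ σ x hσ]
  · refine Integrable.of_bound (C := 1 / (Real.sqrt (2 * Real.pi) * σ)) ?_ ?_
    · refine Measurable.aestronglyMeasurable ?_
      unfold gaussD; fun_prop
    · refine Filter.Eventually.of_forall fun u => ?_
      rw [Real.norm_of_nonneg (hnn u)]
      unfold gaussD
      refine mul_le_of_le_one_right (by positivity) (Real.exp_le_one_iff.2 ?_)
      rw [neg_div]
      exact neg_nonpos.2 (by positivity)

lemma mixM_inter {K : ℕ} (w : Fin K → ℝ) (V : Fin K → Measure ℝ)
    (hd : ∀ i j : Fin K, i ≠ j → Disjoint (msupport (V i)) (msupport (V j)))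
    (k : Fin K) (A : Set ℝ) :
    mixM w V (A ∩ msupport (V k)) = ENNReal.ofReal (w k) * V k A := by
  rw [mixM_apply, Finset.sum_eq_single k]
  · rw [measure_inter_conull (msupport_compl_null _)]
  · intro j _ hj
    rw [measure_mono_null _ (msupport_compl_null (V j)), mul_zero]
    rintro x ⟨_, hx⟩ hx'
    exact Set.disjoint_left.1 (hd j k hj) hx' hx
  · simp

/-- Identifiability (up to permutation) of a finite mixture of location
mixtures of normals whose compactly supported mixing measures satisfy the separation
condition `max_k d_w(supp V_k) < min_{i<j} d_b(supp V_i, supp V_j)`. -/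
theorem stmt2 (K : ℕ) (hK : 1 ≤ K)
    (σ σ' : ℝ) (hσ : 0 < σ) (hσ' : 0 < σ')
    (w w' : Fin K → ℝ) (hw : ∀ k, 0 < w k) (hw' : ∀ k, 0 < w' k)
    (hws : ∑ k, w k = 1) (hws' : ∑ k, w' k = 1)
    (V V' : Fin K → Measure ℝ)
    (hV : ∀ k, IsProbabilityMeasure (V k)) (hV' : ∀ k, IsProbabilityMeasure (V' k))
    (hcpt : ∀ k, IsCompact (msupport (V k))) (hcpt' : ∀ k, IsCompact (msupport (V' k)))
    (hsep : ∀ k i j : Fin K, i < j →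
      dw (msupport (V k)) < db (msupport (V i)) (msupport (V j)))
    (hsep' : ∀ k i j : Fin K, i < j →
      dw (msupport (V' k)) < db (msupport (V' i)) (msupport (V' j)))
    (heq : ∀ x : ℝ,
      (∑ k, w k * ∫ u, gaussD u σ x ∂(V k)) = ∑ k, w' k * ∫ u, gaussD u σ' x ∂(V' k)) :
    σ = σ' ∧ ∃ τ : Equiv.Perm (Fin K), ∀ k, w' k = w (τ k) ∧ V' k = V (τ k) := by
  have hp := mixM_prob w V hw hws hV
  have hp' := mixM_prob w' V' hw' hws' hV'
  have hv : Real.toNNReal (σ ^ 2) ≠ 0 := (Real.toNNReal_pos.2 (by positivity)).ne'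
  have hv' : Real.toNNReal (σ' ^ 2) ≠ 0 := (Real.toNNReal_pos.2 (by positivity)).ne'
  have hconv : mixM w V ∗ ProbabilityTheory.gaussianReal 0 (Real.toNNReal (σ ^ 2))
      = mixM w' V' ∗ ProbabilityTheory.gaussianReal 0 (Real.toNNReal (σ' ^ 2)) := by
    rw [conv_gauss_eq _ hv, conv_gauss_eq _ hv']
    congr 1
    funext x
    rw [mix_lintegral w V hw hV σ hσ, mix_lintegral w' V' hw' hV' σ' hσ', heq]
  have hc : IsCompact (msupport (mixM w V)) := by
    rw [← iUnion_msupport w V hw]; exact isCompact_iUnion hcpt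
  have hc' : IsCompact (msupport (mixM w' V')) := by
    rw [← iUnion_msupport w' V' hw']; exact isCompact_iUnion hcpt'
  have hmain : Real.toNNReal (σ ^ 2) = Real.toNNReal (σ' ^ 2) ∧ mixM w V = mixM w' V' := by
    rcases le_total (Real.toNNReal (σ' ^ 2)) (Real.toNNReal (σ ^ 2)) with h | h
    · exact deconv _ _ hc' h hconv
    · obtain ⟨h1, h2⟩ := deconv _ _ hc h hconv.symm
      exact ⟨h1.symm, h2.symm⟩
  obtain ⟨hs, hM⟩ := hmain
  refine ⟨?_, ?_⟩
  · rw [Real.toNNReal_eq_toNNReal_iff (sq_nonneg _) (sq_nonneg _)] at hs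
    exact (pow_left_inj₀ hσ.le hσ'.le two_ne_zero).1 hs
  have hU : ⋃ k, msupport (V k) = ⋃ k, msupport (V' k) := by
    rw [iUnion_msupport w V hw, iUnion_msupport w' V' hw', hM]
  obtain ⟨τ, hτ⟩ := part_eq hcpt hcpt' (fun k => msupport_nonempty _)
    (fun k => msupport_nonempty _) hU hsep hsep'
  refine ⟨τ, fun k => ?_⟩
  have key : ∀ A, ENNReal.ofReal (w' k) * V' k A = ENNReal.ofReal (w (τ k)) * V (τ k) A := by
    intro A
    rw [← mixM_inter w V (disj_of_sep hsep), ← mixM_inter w' V' (disj_of_sep hsep'), hM, hτ]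
  have h1 : w' k = w (τ k) := by
    have := key Set.univ
    simp only [measure_univ, mul_one] at this
    exact (ENNReal.ofReal_eq_ofReal_iff (hw' k).le (hw _).le).1 this
  refine ⟨h1, Measure.ext fun A _ => ?_⟩
  have := key A
  rw [h1] at this
  exact (ENNReal.mul_right_inj (by simp [hw]) ENNReal.ofReal_ne_top).1 this
end

section
/- There exists a constant c_ψ > 0 such that ‖ψ_{j−1}‖₁ ≤ (2^{17/4} c_ψ / Γ(1/4)²) · j^{1/4} for all j ≥ 1, and such that the following holds. Let σ > 0, c_i ∈ ℝ, r_i > 0, w_i ∈ (0,1], let V_i be a probability measure with supp(V_i) ⊆ [c_i − r_i, c_i + r_i], f_i(x) = ∫ g_{u,σ}(x) dV_i(u), and set λ_{i,j} = w_i ⟨f_i, ψ_{j,c_i,σ}⟩. Let Δ > 0, let ℓ be a nonnegative integer with ℓ ≥ ⌊2e r_i²/σ²⌋ + 1, and let λ̂_{i,j} (j ∈ {0,…,ℓ−1}) be reals with |λ_{i,j} − λ̂_{i,j}| < Δ for all j < ℓ. Then the function f̃_i = Σ_{j=0}^{ℓ−1} λ̂_{i,j} ψ_{j,c_i,σ}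 satisfies ‖w_i f_i − f̃_i‖₁ ≤ (2^{17/4} c_ψ √σ / Γ(1/4)²) Δ ℓ^{5/4} + (2^{17/4} c_ψ r_i w_i / (Γ(1/4)² π^{1/4} σ)) (1/2)^ℓ. -/
open MeasureTheory

/-- Physicists' Hermite polynomials, via the standard three-term recurrence. -/
noncomputable def hermiteP : ℕ → ℝ → ℝ
  | 0 => fun _ => 1
  | 1 => fun x => 2 * x
  | n + 2 => fun x => 2 * x * hermiteP (n + 1) x - 2 * (n + 1) * hermiteP n x

/-- Scaled Hermite function `ψ_{j,μ,σ}`; `ψ_j = ψ_{j,0,1}`. -/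
noncomputable def psiH (j : ℕ) (μ σ : ℝ) (x : ℝ) : ℝ :=
  (-1 : ℝ) ^ j * (Real.sqrt (2 ^ j * (Nat.factorial j : ℝ) * σ * Real.sqrt Real.pi))⁻¹ *
    hermiteP j ((x - μ) / σ) * Real.exp (-(x - μ) ^ 2 / (2 * σ ^ 2))

/-- `L²(ℝ)` inner product. -/
noncomputable def ip (f g : ℝ → ℝ) : ℝ := ∫ x, f x * g x

/-- `L¹(ℝ)` norm. -/
noncomputable def l1norm (f : ℝ → ℝ) : ℝ := ∫ x, |f x|

open Polynomial in
noncomputable def hP : ℕ → ℝ[X]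
  | 0 => 1
  | n + 1 => 2 * X * hP n - derivative (hP n)

open Polynomial in
lemma hP_deriv (n : ℕ) : derivative (hP (n+1)) = C (2 * ((n:ℝ)+1)) * hP n := by
  induction n with
  | zero => simp [hP]; rfl
  | succ n ih =>
    have e : derivative (hP (n+1+1)) = derivative (2 * X * hP (n+1) - derivative (hP (n+1))) := rfl
    have e2 : hP (n+1) = 2 * X * hP n - derivative (hP n) := rfl
    rw [e]
    rw [derivative_sub, derivative_mul, ih, derivative_mul (f := C _)]
    have h2 : derivative ((2 : ℝ[X]) * X) = 2 := by
      have : (2 : ℝ[X]) = C 2 := rfl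
      rw [this]; simp
    rw [h2, derivative_C]
    have h3 : (C (2 * ((n:ℝ)+1)) : ℝ[X]) = C 2 * (C (n:ℝ) + 1) := by simp
    have h4 : (C (2 * (((n+1 : ℕ):ℝ)+1)) : ℝ[X]) = C 2 * (C (n:ℝ) + 1 + 1) := by simp
    have h5 : (2 : ℝ[X]) = C 2 := rfl
    rw [h3, h4, e2, h5]
    ring

open Polynomial in
lemma hP_eval (n : ℕ) (x : ℝ) : hermiteP n x = (hP n).eval x ∧ hermiteP (n+1) x = (hP (n+1)).eval x := by
  induction n with
  | zero => simp [hP, hermiteP]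
  | succ n ih =>
    refine ⟨ih.2, ?_⟩
    have e : (hP (n+1+1)) = (2 * X * hP (n+1) - derivative (hP (n+1))) := rfl
    rw [e, hP_deriv]
    simp [hermiteP, ih.1, ih.2]

lemma hP_eval' (n : ℕ) (x : ℝ) : hermiteP n x = (hP n).eval x := (hP_eval n x).1

open Polynomial in
lemma hP_gen (y s : ℝ) : HasSum (fun n : ℕ => hermiteP n y * s ^ n / (n.factorial : ℝ))
    (Real.exp (2 * y * s - s ^ 2)) := by
  set F : ℂ → ℂ := fun z => Complex.exp (2 * y * z - z ^ 2) with hF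
  have hd : ∀ z, HasDerivAt F (F z * (2 * y - 2 * z)) z := by
    intro z
    have : HasDerivAt (fun z : ℂ => 2 * y * z - z ^ 2) (2 * y - 2 * z) z := by
      have := ((hasDerivAt_id' z).const_mul (2 * (y:ℂ))).fun_sub (hasDerivAt_pow 2 z)
      exact this.congr_deriv (by simp)
    exact this.cexp
  have hit : ∀ n : ℕ, iteratedDeriv n F = fun z => aeval ((y:ℂ) - z) (hP n) * F z := by
    intro n
    induction n with
    | zero => ext z; simp [hP]
    | succ n ih =>
      rw [iteratedDeriv_succ, ih]
      ext z
      have h1 : HasDerivAt (fun z : ℂ => aeval ((y:ℂ) - z) (hP n))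
          (aeval ((y:ℂ) - z) (derivative (hP n)) * (-1)) z := by
        have h2 := (hP n).hasDerivAt_aeval ((y:ℂ) - z)
        have h3 : HasDerivAt (fun z : ℂ => (y:ℂ) - z) (-1) z := by
          simpa using (hasDerivAt_id z).const_sub (y:ℂ)
        exact h2.comp z h3
      rw [(h1.fun_mul (hd z)).deriv]
      simp only [hP, map_sub, map_mul, aeval_X, map_ofNat]
      ring
  have key := Complex.hasSum_taylorSeries_of_entire (f := F) (fun z => (hd z).differentiableAt) 0 (s:ℂ)
  have e2 : F (s:ℂ) = ((Real.exp (2 * y * s - s ^ 2) : ℝ) : ℂ) := by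
    simp [hF]
  rw [e2] at key
  rw [← Complex.hasSum_ofReal]
  have ee : (fun n : ℕ => ((hermiteP n y * s ^ n / (n.factorial : ℝ) : ℝ) : ℂ)) =
      fun n : ℕ => ((n.factorial : ℂ))⁻¹ • ((s:ℂ) - 0) ^ n • iteratedDeriv n F 0 := by
    ext n
    have h0 : aeval (y:ℂ) (hP n) = (((hP n).eval y : ℝ) : ℂ) := by
      have := Polynomial.aeval_algebraMap_apply ℂ y (hP n)
      simpa using this
    rw [hit, hP_eval']
    simp [hF, h0]
    ring
  rw [ee]; exact key

lemma poly_int (p : Polynomial ℝ) (b : ℝ) (hb : 0 < b) : Integrable (fun x => p.eval x * Real.exp (-b * x ^ 2)) := by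
  induction p using Polynomial.induction_on' with
  | add p q hp hq => 
    simp only [Polynomial.eval_add, add_mul]
    exact hp.add hq
  | monomial n a =>
    have := (integrable_rpow_mul_exp_neg_mul_sq hb (s := n) (by have : (0:ℝ) ≤ n := n.cast_nonneg
                                                                linarith)).const_mul a
    simpa [mul_assoc] using this

lemma poly_int2 (p : Polynomial ℝ) (t : ℝ) : Integrable (fun x => p.eval x * Real.exp (-x ^ 2 + x * t)) := by
  refine ((poly_int p (1/2) (by norm_num)).norm.const_mul (Real.exp (t^2/2))).mono' ?_ ?_
  · exact (by fun_prop : Continuous _).aestronglyMeasurable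
  · refine Filter.Eventually.of_forall fun x => ?_
    rw [norm_mul, norm_mul, Real.norm_of_nonneg (Real.exp_pos _).le, Real.norm_of_nonneg (Real.exp_pos _).le]
    rw [mul_left_comm, ← Real.exp_add]
    refine mul_le_mul_of_nonneg_left (Real.exp_le_exp.2 ?_) (norm_nonneg _)
    nlinarith [sq_nonneg (x - t)]

open Polynomial in
lemma hP_I (n : ℕ) (t : ℝ) : ∫ x, (hP n).eval x * Real.exp (-x ^ 2 + x * t) =
    Real.sqrt Real.pi * t ^ n * Real.exp (t ^ 2 / 4) := by
  induction n with
  | zero =>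
    have e : ∀ x : ℝ, (hP 0).eval x * Real.exp (-x ^ 2 + x * t) =
      Real.exp (t ^ 2 / 4) * Real.exp (-1 * (x - t / 2) ^ 2) := by
      intro x; rw [← Real.exp_add]; simp [hP]; ring
    simp_rw [e]
    rw [integral_const_mul, integral_sub_right_eq_self (fun x => Real.exp (-1 * x ^ 2)) (t/2), integral_gaussian]
    simp; ring
  | succ n ih =>
    have hder : ∀ x : ℝ, HasDerivAt (fun x => (hP n).eval x * Real.exp (-x ^ 2 + x * t))
        (t * ((hP n).eval x * Real.exp (-x ^ 2 + x * t)) - (hP (n+1)).eval x * Real.exp (-x ^ 2 + x * t)) x := by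
      intro x
      have h1 := (hP n).hasDerivAt x
      have h2 : HasDerivAt (fun x : ℝ => -x ^ 2 + x * t) (-(2 * x) + t) x := by
        have := (hasDerivAt_pow 2 x).fun_neg.fun_add ((hasDerivAt_id' x).mul_const t)
        exact this.congr_deriv (by simp)
      refine (h1.fun_mul h2.exp).congr_deriv ?_
      simp [hP]; ring
    have h0 := integral_eq_zero_of_hasDerivAt_of_integrable hder
      (((poly_int2 (hP n) t).const_mul t).sub (poly_int2 (hP (n+1)) t)) (poly_int2 (hP n) t)
    rw [integral_sub ((poly_int2 (hP n) t).const_mul t) (poly_int2 (hP (n+1)) t), integral_const_mul, ih] at h0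
    rw [pow_succ]; linarith

open Polynomial in
lemma hP_N (n : ℕ) : ∫ x, (hP n).eval x ^ 2 * Real.exp (-x ^ 2) = 2 ^ n * (n.factorial : ℝ) * Real.sqrt Real.pi := by
  induction n with
  | zero =>
    have := integral_gaussian 1
    simpa [hP] using this
  | succ n ih =>
    have hder : ∀ x : ℝ, HasDerivAt (fun x => (hP (n+1) * hP n).eval x * Real.exp (-x ^ 2 + x * 0))
        (2 * (n + 1) * ((hP n ^ 2).eval x * Real.exp (-x ^ 2 + x * 0)) - (hP (n+1) ^ 2).eval x * Real.exp (-x ^ 2 + x * 0)) x := by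
      intro x
      have h1 := (hP (n+1) * hP n).hasDerivAt x
      have h2 : HasDerivAt (fun x : ℝ => -x ^ 2 + x * 0) (-(2 * x)) x := by
        have := (hasDerivAt_pow 2 x).fun_neg.fun_add ((hasDerivAt_id' x).mul_const (0:ℝ))
        exact this.congr_deriv (by simp)
      refine (h1.fun_mul h2.exp).congr_deriv ?_
      rw [derivative_mul, hP_deriv]
      have e2 : hP (n+1) = 2 * X * hP n - derivative (hP n) := rfl
      simp [e2]; ring
    have h0 := integral_eq_zero_of_hasDerivAt_of_integrable hder
      (((poly_int2 (hP n ^ 2) 0).const_mul _).sub (poly_int2 (hP (n+1) ^ 2) 0)) (poly_int2 _ 0)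
    rw [integral_sub ((poly_int2 (hP n ^ 2) 0).const_mul _) (poly_int2 (hP (n+1) ^ 2) 0), integral_const_mul] at h0
    simp only [mul_zero, add_zero, eval_pow, ih] at h0
    rw [Nat.factorial_succ, pow_succ]; push_cast; linarith

noncomputable def nrm (j : ℕ) : ℝ := Real.sqrt (2 ^ j * (Nat.factorial j : ℝ) * Real.sqrt Real.pi)

lemma nrm_pos (j : ℕ) : 0 < nrm j := by
  unfold nrm
  have := Real.pi_pos
  have := Nat.factorial_pos j
  positivity

lemma nrm_sq (j : ℕ) : nrm j ^ 2 = 2 ^ j * (Nat.factorial j : ℝ) * Real.sqrt Real.pi := by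
  unfold nrm
  rw [Real.sq_sqrt]; positivity

lemma psi01 (j : ℕ) (y : ℝ) :
    psiH j 0 1 y = (-1) ^ j * (nrm j)⁻¹ * ((hP j).eval y * Real.exp (-(1/2) * y ^ 2)) := by
  unfold psiH nrm
  rw [hP_eval', mul_one, sub_zero, div_one, ← mul_assoc]
  congr 2; ring

lemma psi_scale (j : ℕ) (c σ x : ℝ) (hσ : 0 < σ) :
    psiH j c σ x = (Real.sqrt σ)⁻¹ * psiH j 0 1 ((x - c) / σ) := by
  unfold psiH
  have h1 : 2 ^ j * (j.factorial : ℝ) * σ * Real.sqrt Real.pi =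
    σ * (2 ^ j * (j.factorial : ℝ) * 1 * Real.sqrt Real.pi) := by ring
  rw [h1, Real.sqrt_mul hσ.le, mul_inv, sub_zero, div_one]
  have h2 : -(x - c) ^ 2 / (2 * σ ^ 2) = -((x - c) / σ) ^ 2 / (2 * 1 ^ 2) := by
    field_simp
  rw [h2]; ring

lemma phi_int (j : ℕ) : Integrable (psiH j 0 1) := by
  have e : psiH j 0 1 = _ := funext (psi01 j)
  rw [e]
  exact (poly_int (hP j) (1/2) (by norm_num)).const_mul _

lemma phi_cont (j : ℕ) : Continuous (psiH j 0 1) := by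
  have e : psiH j 0 1 = _ := funext (psi01 j)
  rw [e]
  fun_prop

lemma poly_int1 (p : Polynomial ℝ) : Integrable (fun x => p.eval x * Real.exp (-x ^ 2)) := by
  have := poly_int p 1 one_pos
  simpa using this

open Polynomial in
lemma hP_M (n : ℕ) : ∫ x, (X * hP n).eval x ^ 2 * Real.exp (-x ^ 2) ≤ (2 * n + 1) * nrm n ^ 2 := by
  have hI : ∀ p : ℝ[X], Integrable (fun x => p.eval x ^ 2 * Real.exp (-x ^ 2)) := by
    intro p
    have := poly_int1 (p ^ 2)
    simpa using this
  have h1 : ∫ x, (X * hP n).eval x ^ 2 * Real.exp (-x ^ 2) ≤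
      ∫ x, ((1/2) * ((hP (n+1)).eval x ^ 2 * Real.exp (-x ^ 2)) + (1/2) * ((derivative (hP n)).eval x ^ 2 * Real.exp (-x ^ 2))) := by
    refine integral_mono (hI _) (((hI _).const_mul _).add ((hI _).const_mul _)) fun x => ?_
    have e2 : (hP (n+1)).eval x = 2 * x * (hP n).eval x - (derivative (hP n)).eval x := by
      simp [hP]
    have : (X * hP n).eval x = ((hP (n+1)).eval x + (derivative (hP n)).eval x) / 2 := by
      rw [e2]; simp; ring
    simp only [this]
    have hp := Real.exp_pos (-x ^ 2)
    have : (((hP (n+1)).eval x + (derivative (hP n)).eval x) / 2) ^ 2 ≤ (1/2) * (hP (n+1)).eval x ^ 2 + (1/2) * (derivative (hP n)).eval x ^ 2 := by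
      nlinarith [sq_nonneg ((hP (n+1)).eval x - (derivative (hP n)).eval x)]
    nlinarith [mul_le_mul_of_nonneg_right this hp.le]
  rw [integral_add ((hI _).const_mul _) ((hI _).const_mul _), integral_const_mul, integral_const_mul, hP_N] at h1
  refine h1.trans ?_
  rw [nrm_sq]
  have hs := Real.sqrt_nonneg Real.pi
  cases n with
  | zero => simp [hP]
  | succ m =>
    have : ∫ x, (derivative (hP (m+1))).eval x ^ 2 * Real.exp (-x ^ 2) = (2 * ((m:ℝ)+1)) ^ 2 * (2 ^ m * (m.factorial : ℝ) * Real.sqrt Real.pi) := by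
      rw [← hP_N, ← integral_const_mul]
      congr 1; ext x
      rw [hP_deriv]; simp; ring
    rw [this, Nat.factorial_succ, Nat.factorial_succ]
    push_cast
    apply le_of_eq; ring

lemma cauchy_int (a : ℝ) (ha : 0 < a) : Integrable (fun x : ℝ => (a ^ 4 + x ^ 2)⁻¹) ∧
    ∫ x : ℝ, (a ^ 4 + x ^ 2)⁻¹ = Real.pi / a ^ 2 := by
  have e : (fun x : ℝ => (a ^ 4 + x ^ 2)⁻¹) = fun x : ℝ => (a ^ 4)⁻¹ * (1 + (x / a ^ 2) ^ 2)⁻¹ := by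
    ext x
    field_simp
  constructor
  · rw [e]
    exact ((integrable_inv_one_add_sq).comp_div (by positivity)).const_mul _
  · rw [e, integral_const_mul, Measure.integral_comp_div (fun x : ℝ => (1 + x ^ 2)⁻¹), integral_univ_inv_one_add_sq,
      abs_of_pos (by positivity), smul_eq_mul]
    field_simp

lemma phi_l1 (n : ℕ) : l1norm (psiH n 0 1) ≤ 4 * ((n:ℝ) + 1) ^ ((1:ℝ)/4) := by
  set a : ℝ := ((n:ℝ) + 1) ^ ((1:ℝ)/4) with hadef
  have hA : (0:ℝ) < n + 1 := by positivity
  have ha : 0 < a := Real.rpow_pos_of_pos hA _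
  have ha4 : a ^ 4 = n + 1 := by
    rw [hadef, ← Real.rpow_natCast, ← Real.rpow_mul hA.le]; norm_num
  have hn := nrm_pos n
  have hI1 : Integrable (fun x => (hP n).eval x ^ 2 * Real.exp (-x ^ 2)) := by
    have := poly_int1 (hP n ^ 2)
    simpa using this
  have hI2 : Integrable (fun x => (Polynomial.X * hP n).eval x ^ 2 * Real.exp (-x ^ 2)) := by
    have := poly_int1 ((Polynomial.X * hP n) ^ 2)
    simpa only [Polynomial.eval_pow] using this
  obtain ⟨hI3, hv3⟩ := cauchy_int a ha
  have hI12 : Integrable (fun x => a ^ 4 * ((hP n).eval x ^ 2 * Real.exp (-x ^ 2)) +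
      (Polynomial.X * hP n).eval x ^ 2 * Real.exp (-x ^ 2)) := (hI1.const_mul (a ^ 4)).add hI2
  have hb : l1norm (psiH n 0 1) ≤ ∫ x, (((2 * a ^ 3 * nrm n ^ 2)⁻¹ * (a ^ 4 * ((hP n).eval x ^ 2 * Real.exp (-x ^ 2)) +
      (Polynomial.X * hP n).eval x ^ 2 * Real.exp (-x ^ 2))) + (a ^ 3 / 2) * (a ^ 4 + x ^ 2)⁻¹) := by
    unfold l1norm
    refine integral_mono (phi_int n).abs ((hI12.const_mul _).add (hI3.const_mul _)) fun x => ?_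
    simp only
    set P := |psiH n 0 1 x| with hP'
    have hsq : (hP n).eval x ^ 2 * Real.exp (-x ^ 2) = nrm n ^ 2 * P ^ 2 := by
      have e1 : Real.exp (-x ^ 2) = Real.exp (-(1/2) * x ^ 2) ^ 2 := by
        rw [← Real.exp_nat_mul]; congr 1; push_cast; ring
      rw [hP', sq_abs, psi01, e1]
      have : ((-1:ℝ) ^ n) ^ 2 = 1 := by rw [← pow_mul, mul_comm, pow_mul]; simp
      rw [mul_pow, mul_pow, this]
      field_simp
    have hsq2 : (Polynomial.X * hP n).eval x ^ 2 * Real.exp (-x ^ 2) = x ^ 2 * (nrm n ^ 2 * P ^ 2) := by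
      rw [← hsq]; simp; ring
    rw [hsq, hsq2]
    have hq : 0 < a ^ 4 + x ^ 2 := by positivity
    have : (2 * a ^ 3 * nrm n ^ 2)⁻¹ * (a ^ 4 * (nrm n ^ 2 * P ^ 2) + x ^ 2 * (nrm n ^ 2 * P ^ 2)) +
        a ^ 3 / 2 * (a ^ 4 + x ^ 2)⁻¹ - P = (2 * a ^ 3)⁻¹ * (a ^ 4 + x ^ 2)⁻¹ * (P * (a ^ 4 + x ^ 2) - a ^ 3) ^ 2 := by
      field_simp
      ring
    have h3 : 0 ≤ (2 * a ^ 3)⁻¹ * (a ^ 4 + x ^ 2)⁻¹ * (P * (a ^ 4 + x ^ 2) - a ^ 3) ^ 2 := by positivity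
    linarith
  rw [integral_add (hI12.const_mul _) (hI3.const_mul _), integral_const_mul, integral_const_mul,
    integral_add (hI1.const_mul _) hI2, integral_const_mul, hv3, hP_N, ← nrm_sq] at hb
  refine hb.trans ?_
  have hM := hP_M n
  have h4 : (2 * a ^ 3 * nrm n ^ 2)⁻¹ * (a ^ 4 * nrm n ^ 2 + ∫ x, (Polynomial.X * hP n).eval x ^ 2 * Real.exp (-x ^ 2)) ≤
      (2 * a ^ 3 * nrm n ^ 2)⁻¹ * (a ^ 4 * nrm n ^ 2 + 2 * a ^ 4 * nrm n ^ 2) := by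
    refine mul_le_mul_of_nonneg_left ?_ (by positivity)
    rw [ha4]
    nlinarith [sq_nonneg (nrm n)]
  have h5 : (2 * a ^ 3 * nrm n ^ 2)⁻¹ * (a ^ 4 * nrm n ^ 2 + 2 * a ^ 4 * nrm n ^ 2) = 3 / 2 * a := by
    field_simp; ring
  have h6 : a ^ 3 / 2 * (Real.pi / a ^ 2) = Real.pi / 2 * a := by field_simp
  rw [h6]
  nlinarith [Real.pi_le_four]

noncomputable def Aco (j : ℕ) (t : ℝ) : ℝ :=
  (-1) ^ j * Real.sqrt Real.pi * Real.exp (-(t ^ 2) / 4) * t ^ j / nrm j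

lemma neg_one_sq' (j : ℕ) : (-1 : ℝ) ^ j * (-1) ^ j = 1 := by
  rw [← mul_pow]; simp

lemma co_aux (j : ℕ) (t y : ℝ) :
    Real.sqrt Real.pi * t ^ j / nrm j * ((nrm j)⁻¹ * (hP j).eval y) =
      hermiteP j y * (t / 2) ^ j / (j.factorial : ℝ) := by
  have h1 := nrm_pos j
  have h2 := nrm_sq j
  have h3 : (0:ℝ) < j.factorial := by exact_mod_cast Nat.factorial_pos j
  have h4 : 0 < Real.sqrt Real.pi := Real.sqrt_pos.2 Real.pi_pos
  rw [hP_eval', div_pow]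
  have : Real.sqrt Real.pi * t ^ j / nrm j * ((nrm j)⁻¹ * (hP j).eval y) =
    Real.sqrt Real.pi * t ^ j * (hP j).eval y / nrm j ^ 2 := by field_simp
  rw [this, h2]
  field_simp

lemma expand (t y : ℝ) :
    HasSum (fun j => Aco j t * psiH j 0 1 y) (Real.exp (-(y - t) ^ 2 / 2)) := by
  have h := (hP_gen y (t/2)).mul_left (Real.exp (-(t ^ 2) / 4) * Real.exp (-(1/2) * y ^ 2))
  rw [← Real.exp_add, ← Real.exp_add] at h
  have e : -(t ^ 2) / 4 + -(1/2) * y ^ 2 + (2 * y * (t / 2) - (t / 2) ^ 2) = -(y - t) ^ 2 / 2 := by ring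
  rw [e] at h
  have ef : (fun j => Aco j t * psiH j 0 1 y) = fun j : ℕ =>
      Real.exp (-(t ^ 2) / 4 + -(1/2) * y ^ 2) * (hermiteP j y * (t / 2) ^ j / (j.factorial : ℝ)) := by
    ext j
    rw [← co_aux, psi01, Real.exp_add]
    unfold Aco
    linear_combination (Real.sqrt Real.pi * Real.exp (-(t ^ 2) / 4) * t ^ j / nrm j * ((nrm j)⁻¹ * ((hP j).eval y * Real.exp (-(1/2) * y ^ 2)))) * neg_one_sq' j
  rw [ef]; exact h

noncomputable def bco (j : ℕ) (ρ : ℝ) : ℝ := Real.sqrt Real.pi * ρ ^ j / nrm j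

lemma bco_nonneg (j : ℕ) (ρ : ℝ) (h : 0 ≤ ρ) : 0 ≤ bco j ρ := by
  have := nrm_pos j
  unfold bco; positivity

lemma Aco_le (j : ℕ) (t ρ : ℝ) (h : |t| ≤ ρ) : |Aco j t| ≤ bco j ρ := by
  unfold Aco bco
  have h1 := nrm_pos j
  rw [abs_div, abs_mul, abs_mul, abs_mul, abs_pow, abs_pow, abs_neg, abs_one, one_pow, one_mul, abs_of_pos h1,
    abs_of_nonneg (Real.sqrt_nonneg _), abs_of_pos (Real.exp_pos _)]
  have h2 : Real.exp (-(t ^ 2) / 4) ≤ 1 := Real.exp_le_one_iff.2 (by nlinarith [sq_nonneg t])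
  have h3 : |t| ^ j ≤ ρ ^ j := pow_le_pow_left₀ (abs_nonneg _) h j
  have h4 : Real.sqrt Real.pi * Real.exp (-(t ^ 2) / 4) * |t| ^ j ≤ Real.sqrt Real.pi * 1 * ρ ^ j := by gcongr
  rw [mul_one] at h4
  exact div_le_div_of_nonneg_right h4 h1.le

lemma bsummable (ρ y : ℝ) (h : 0 ≤ ρ) : Summable (fun j => bco j ρ * |psiH j 0 1 y|) := by
  have h := ((hP_gen y (ρ/2)).summable.abs).mul_left (Real.exp (-(1/2) * y ^ 2))
  refine h.congr fun j => ?_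
  rw [← co_aux, psi01, ← abs_of_nonneg (bco_nonneg j ρ ‹_›), ← abs_mul]
  rw [← abs_of_pos (Real.exp_pos (-(1/2) * y ^ 2)), ← abs_mul]
  unfold bco
  rw [abs_of_pos (Real.exp_pos (-(1/2) * y ^ 2))]
  have : Real.sqrt Real.pi * ρ ^ j / nrm j *
      ((-1) ^ j * (nrm j)⁻¹ * ((hP j).eval y * Real.exp (-(1/2) * y ^ 2))) =
    (-1) ^ j * (Real.exp (-(1/2) * y ^ 2) * (Real.sqrt Real.pi * ρ ^ j / nrm j * ((nrm j)⁻¹ * (hP j).eval y))) := by ring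
  rw [this, abs_mul ((-1) ^ j)]
  simp

lemma coef (j : ℕ) (t : ℝ) : ∫ y, Real.exp (-(y - t) ^ 2 / 2) * psiH j 0 1 y = Aco j t := by
  have h1 := nrm_pos j
  have e : ∀ y, Real.exp (-(y - t) ^ 2 / 2) * psiH j 0 1 y =
     ((-1) ^ j * (nrm j)⁻¹ * Real.exp (-(t ^ 2) / 2)) * ((hP j).eval y * Real.exp (-y ^ 2 + y * t)) := by
    intro y
    rw [psi01]
    have : Real.exp (-(y - t) ^ 2 / 2) * Real.exp (-(1/2) * y ^ 2) = Real.exp (-(t ^ 2) / 2) * Real.exp (-y ^ 2 + y * t) := by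
      rw [← Real.exp_add, ← Real.exp_add]; congr 1; ring
    linear_combination ((-1) ^ j * (nrm j)⁻¹ * (hP j).eval y) * this
  simp_rw [e]
  rw [integral_const_mul, hP_I]
  have : Real.exp (-(t ^ 2) / 2) * Real.exp (t ^ 2 / 4) = Real.exp (-(t ^ 2) / 4) := by
    rw [← Real.exp_add]; congr 1; ring
  unfold Aco
  rw [← this]; ring

lemma tail_term (j : ℕ) (ρ : ℝ) (hρ : 0 ≤ ρ) (hj : 1 ≤ j) (h : 2 * Real.exp 1 * ρ ^ 2 ≤ j) :
    bco j ρ * l1norm (psiH j 0 1) ≤ 40 * ρ * (1/2) ^ j := by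
  have hn := nrm_pos j
  have hj0 : (1:ℝ) ≤ j := by exact_mod_cast hj
  have hs : (1:ℝ) ≤ Real.sqrt Real.pi := Real.one_le_sqrt.2 (by linarith [Real.pi_gt_three])
  have hs2 : Real.sqrt Real.pi ^ 2 = Real.pi := Real.sq_sqrt Real.pi_pos.le
  -- square bound
  have key : ρ ^ j * (Real.sqrt j) ≤ nrm j * (3 * ρ * (1/2) ^ j) := by
    refine le_of_sq_le_sq ?_ (by positivity)
    rw [mul_pow, mul_pow, Real.sq_sqrt (by positivity), nrm_sq]
    obtain ⟨m, rfl⟩ : ∃ m, j = m + 1 := ⟨j - 1, by omega⟩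
    have h1 : (2 * Real.exp 1 * ρ ^ 2) ^ m ≤ ((m + 1 : ℕ) : ℝ) ^ m := pow_le_pow_left₀ (by positivity) h m
    have h2 := Real.pow_div_factorial_le_exp (x := ((m + 1 : ℕ) : ℝ)) (by positivity) (m+1)
    have hf : (0:ℝ) < ((m+1).factorial : ℝ) := by exact_mod_cast Nat.factorial_pos _
    rw [div_le_iff₀ hf] at h2
    have h3 : Real.exp ((m + 1 : ℕ) : ℝ) = Real.exp 1 ^ (m + 1) := by
      rw [← Real.exp_nat_mul, mul_one]
    rw [h3] at h2
    set J : ℝ := ((m + 1 : ℕ) : ℝ)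
    set f : ℝ := ((m+1).factorial : ℝ)
    have he : Real.exp 1 < 3 := Real.exp_one_lt_three
    have he0 := Real.exp_pos 1
    -- ρ^(2m) * J * (2e)^m ≤ J^(m+1) ≤ e^(m+1) f
    have h4 : (2:ℝ) ^ m * (ρ ^ 2) ^ m * J ≤ Real.exp 1 * f := by
      have : Real.exp 1 ^ m * ((2:ℝ) ^ m * (ρ ^ 2) ^ m * J) ≤ Real.exp 1 ^ m * (Real.exp 1 * f) := by
        calc _ = (2 * Real.exp 1 * ρ ^ 2) ^ m * J := by rw [mul_pow, mul_pow]; ring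
          _ ≤ J ^ m * J := by gcongr
          _ = J ^ (m+1) := by ring
          _ ≤ _ := h2
          _ = _ := by ring
      exact le_of_mul_le_mul_left this (by positivity)
    have h5 : (2:ℝ) ^ m * (ρ ^ 2) ^ m * J ≤ 3 * f := h4.trans (by gcongr)
    have e1 : (2:ℝ) ^ (m+1) * f * Real.sqrt Real.pi * (3 * ρ * (1/2) ^ (m+1)) ^ 2 = 
      (1 / 2) ^ m * (ρ ^ 2 * (3 * f)) * (Real.sqrt Real.pi * (3 / 2)) := by
      have : (2:ℝ) ^ m * (1/2) ^ m = 1 := by rw [← mul_pow]; norm_num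
      rw [pow_succ, pow_succ]
      linear_combination (9 / 2 * f * Real.sqrt Real.pi * ρ ^ 2 * (1/2) ^ m) * this
    have e2 : (ρ ^ (m+1)) ^ 2 * J = (1/2) ^ m * (ρ ^ 2 * ((2:ℝ) ^ m * (ρ ^ 2) ^ m * J)) := by
      have : (2:ℝ) ^ m * (1/2) ^ m = 1 := by rw [← mul_pow]; norm_num
      have h8 : (ρ ^ (m+1)) ^ 2 = ρ ^ 2 * (ρ ^ 2) ^ m := by ring
      rw [h8]
      linear_combination (-(ρ ^ 2 * (ρ ^ 2) ^ m * J)) * this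
    rw [e1, e2]
    have h9 : (1/2:ℝ) ^ m * (ρ ^ 2 * ((2:ℝ) ^ m * (ρ ^ 2) ^ m * J)) ≤ (1/2) ^ m * (ρ ^ 2 * (3 * f)) := by gcongr
    have h10 : 0 ≤ (1/2:ℝ) ^ m * (ρ ^ 2 * (3 * f)) := by positivity
    nlinarith
  have hl := phi_l1 j
  have h11 : ((j:ℝ) + 1) ^ ((1:ℝ)/4) ≤ Real.sqrt 2 * Real.sqrt j := by
    rw [← Real.sqrt_mul (by norm_num), Real.sqrt_eq_rpow]
    calc ((j:ℝ) + 1) ^ ((1:ℝ)/4) ≤ ((j:ℝ) + 1) ^ ((1:ℝ)/2) := Real.rpow_le_rpow_of_exponent_le (by linarith) (by norm_num)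
      _ ≤ _ := Real.rpow_le_rpow (by positivity) (by linarith) (by norm_num)
  have h12 : l1norm (psiH j 0 1) ≤ 4 * (Real.sqrt 2 * Real.sqrt j) := hl.trans (by gcongr)
  calc bco j ρ * l1norm (psiH j 0 1) ≤ bco j ρ * (4 * (Real.sqrt 2 * Real.sqrt j)) :=
        mul_le_mul_of_nonneg_left h12 (bco_nonneg j ρ hρ)
    _ = 4 * Real.sqrt 2 * Real.sqrt Real.pi * ((ρ ^ j * Real.sqrt j) / nrm j) := by unfold bco; ring
    _ ≤ 4 * Real.sqrt 2 * Real.sqrt Real.pi * (3 * ρ * (1/2) ^ j) := by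
        gcongr
        rw [div_le_iff₀ hn]; linarith
    _ ≤ _ := by
        have h13 : Real.sqrt 2 * Real.sqrt Real.pi ≤ 10 / 3 := by
          rw [← Real.sqrt_mul (by norm_num), Real.sqrt_le_iff]
          constructor <;> nlinarith [Real.pi_lt_d2]
        have : 0 ≤ ρ * (1/2:ℝ) ^ j := by positivity
        nlinarith


lemma phi_l1_pos (j : ℕ) : 0 < l1norm (psiH j 0 1) := by
  have h := coef j 1
  have hA : Aco j 1 ≠ 0 := by
    unfold Aco
    have := nrm_pos j
    have := Real.sqrt_pos.2 Real.pi_pos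
    have := Real.exp_pos (-((1:ℝ) ^ 2) / 4)
    have h1 : (-1 : ℝ) ^ j ≠ 0 := pow_ne_zero _ (by norm_num)
    simp only [one_pow, mul_one]
    positivity
  have h2 : |Aco j 1| ≤ l1norm (psiH j 0 1) := by
    rw [← h]
    refine (abs_integral_le_integral_abs).trans ?_
    refine integral_mono_of_nonneg (Filter.Eventually.of_forall fun x => abs_nonneg _) (phi_int j).abs
      (Filter.Eventually.of_forall fun x => ?_)
    simp only
    rw [abs_mul, abs_of_pos (Real.exp_pos _)]
    refine mul_le_of_le_one_left (abs_nonneg _) (Real.exp_le_one_iff.2 ?_)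
    nlinarith [sq_nonneg (x - 1)]
  exact (abs_pos.2 hA).trans_le h2

lemma tail_int (l : ℕ) (ρ : ℝ) (hρ : 0 < ρ) (hl : 1 ≤ l) (h : 2 * Real.exp 1 * ρ ^ 2 ≤ l) :
    Integrable (fun y => ∑' j, bco (j + l) ρ * |psiH (j + l) 0 1 y|) ∧
    ∫ y, ∑' j, bco (j + l) ρ * |psiH (j + l) 0 1 y| ≤ 80 * ρ * (1/2) ^ l := by
  have hb : ∀ j, bco (j + l) ρ * l1norm (psiH (j + l) 0 1) ≤ 40 * ρ * (1/2) ^ l * (1/2) ^ j := by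
    intro j
    refine (tail_term (j + l) ρ hρ.le (by omega) (h.trans (by push_cast; linarith [(Nat.cast_nonneg j : (0:ℝ) ≤ j)]))).trans (le_of_eq ?_)
    rw [pow_add]; ring
  have hpos : ∀ j, 0 < bco (j + l) ρ * l1norm (psiH (j + l) 0 1) := by
    intro j
    refine mul_pos ?_ (phi_l1_pos _)
    have := nrm_pos (j + l)
    have := Real.pi_pos
    unfold bco; positivity
  have hg : HasSum (fun j : ℕ => 40 * ρ * (1/2) ^ l * (1/2 : ℝ) ^ j) (40 * ρ * (1/2) ^ l * 2) :=
    hasSum_geometric_two.mul_left _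
  have hsum : Summable (fun j => bco (j + l) ρ * l1norm (psiH (j + l) 0 1)) :=
    hg.summable.of_nonneg_of_le (fun j => (hpos j).le) hb
  have hint : ∀ j, ∫ y, bco (j + l) ρ * |psiH (j + l) 0 1 y| = bco (j + l) ρ * l1norm (psiH (j + l) 0 1) := by
    intro j; rw [integral_const_mul]; rfl
  have hn : ∀ j, ∫ y, ‖bco (j + l) ρ * |psiH (j + l) 0 1 y|‖ = bco (j + l) ρ * l1norm (psiH (j + l) 0 1) := by
    intro j
    rw [← hint]
    congr 1; ext y
    exact Real.norm_of_nonneg (mul_nonneg (bco_nonneg _ _ hρ.le) (abs_nonneg _))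
  have H := hasSum_integral_of_summable_integral_norm (μ := volume)
    (F := fun j y => bco (j + l) ρ * |psiH (j + l) 0 1 y|)
    (fun j => (phi_int (j + l)).abs.const_mul _) (by simp_rw [hn]; exact hsum)
  simp_rw [hint] at H
  constructor
  · apply Integrable.of_integral_ne_zero
    have : bco (0 + l) ρ * l1norm (psiH (0 + l) 0 1) ≤ _ := le_hasSum H 0 (fun j _ => (hpos j).le)
    exact ((hpos 0).trans_le this).ne'
  · refine (hasSum_le hb H hg).trans (le_of_eq ?_)
    ring

lemma gauss_eq (u c σ x : ℝ) (hσ : 0 < σ) : gaussD u σ x =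
    (1 / (Real.sqrt (2 * Real.pi) * σ)) * Real.exp (-((x - c) / σ - (u - c) / σ) ^ 2 / 2) := by
  unfold gaussD
  congr 2
  field_simp
  ring

lemma int_scale (F : ℝ → ℝ) (c σ : ℝ) (hσ : 0 < σ) : ∫ x, F ((x - c) / σ) = σ * ∫ y, F y := by
  rw [integral_sub_right_eq_self (fun x => F (x / σ)) c, Measure.integral_comp_div, abs_of_pos hσ, smul_eq_mul]

lemma int_scale' (F : ℝ → ℝ) (c σ : ℝ) (hσ : 0 < σ) (hF : Integrable F) :
    Integrable (fun x => F ((x - c) / σ)) :=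
  (hF.comp_div hσ.ne').comp_sub_right c

lemma gauss_le (u σ x : ℝ) (hσ : 0 < σ) : |gaussD u σ x| ≤ 1 / (Real.sqrt (2 * Real.pi) * σ) := by
  unfold gaussD
  have : 0 < Real.sqrt (2 * Real.pi) := Real.sqrt_pos.2 (by positivity)
  rw [abs_mul, abs_of_pos (Real.exp_pos _), abs_of_pos (by positivity)]
  refine mul_le_of_le_one_right (by positivity) (Real.exp_le_one_iff.2 ?_)
  rw [neg_div]
  have : 0 ≤ (x - u) ^ 2 / (2 * σ ^ 2) := by positivity
  linarith

lemma psi_int (j : ℕ) (c σ : ℝ) (hσ : 0 < σ) : Integrable (psiH j c σ) := by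
  have e : psiH j c σ = fun x => (Real.sqrt σ)⁻¹ * psiH j 0 1 ((x - c) / σ) :=
    funext fun x => psi_scale j c σ x hσ
  rw [e]
  exact (int_scale' _ c σ hσ (phi_int j)).const_mul _

lemma psi_l1 (j : ℕ) (c σ : ℝ) (hσ : 0 < σ) : ∫ x, |psiH j c σ x| = Real.sqrt σ * l1norm (psiH j 0 1) := by
  have e : ∀ x, |psiH j c σ x| = (Real.sqrt σ)⁻¹ * |psiH j 0 1 ((x - c) / σ)| := by
    intro x
    rw [psi_scale j c σ x hσ, abs_mul, abs_of_nonneg (by positivity)]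
  simp_rw [e]
  rw [integral_const_mul, int_scale (fun y => |psiH j 0 1 y|) c σ hσ]
  have := Real.sq_sqrt hσ.le
  have h2 := Real.sqrt_pos.2 hσ
  unfold l1norm
  field_simp
  rw [this]

lemma gauss_cont (σ x : ℝ) : Continuous (fun u => gaussD u σ x) := by
  unfold gaussD; fun_prop

lemma Aco_cont (j : ℕ) : Continuous (Aco j) := by
  unfold Aco; fun_prop

lemma ip_eq (V : Measure ℝ) [IsProbabilityMeasure V] (j : ℕ) (c σ : ℝ) (hσ : 0 < σ) :
    ip (fun x => ∫ u, gaussD u σ x ∂V) (psiH j c σ) =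
      ∫ u, (1 / (Real.sqrt (2 * Real.pi) * σ)) * Real.sqrt σ * Aco j ((u - c) / σ) ∂V := by
  unfold ip
  simp_rw [← integral_mul_const]
  have hpc : Continuous (psiH j c σ) := by
    have e : psiH j c σ = fun x => (Real.sqrt σ)⁻¹ * psiH j 0 1 ((x - c) / σ) :=
      funext fun x => psi_scale j c σ x hσ
    rw [e]
    have := phi_cont j
    fun_prop
  rw [integral_integral_swap]
  · congr 1; ext u
    have e : ∀ x, gaussD u σ x * psiH j c σ x = (1 / (Real.sqrt (2 * Real.pi) * σ)) * (Real.sqrt σ)⁻¹ *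
       ((fun y => Real.exp (-(y - (u - c) / σ) ^ 2 / 2) * psiH j 0 1 y) ((x - c) / σ)) := by
      intro x
      rw [gauss_eq u c σ x hσ, psi_scale j c σ x hσ]; ring
    simp_rw [e]
    rw [integral_const_mul, int_scale (fun y => Real.exp (-(y - (u - c) / σ) ^ 2 / 2) * psiH j 0 1 y) c σ hσ, coef]
    have := Real.sq_sqrt hσ.le
    have h2 := Real.sqrt_pos.2 hσ
    have h3 : (Real.sqrt σ)⁻¹ * σ = Real.sqrt σ := by
      field_simp; exact this.symm
    linear_combination (1 / (Real.sqrt (2 * Real.pi) * σ) * Aco j ((u - c) / σ)) * h3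
  · have hd : Integrable (fun z : ℝ × ℝ => |psiH j c σ z.1| * (1 / (Real.sqrt (2 * Real.pi) * σ))) (volume.prod V) :=
      (psi_int j c σ hσ).abs.mul_prod (integrable_const (μ := V) (1 / (Real.sqrt (2 * Real.pi) * σ)))
    refine hd.mono' ?_ ?_
    · apply Continuous.aestronglyMeasurable
      simp only [Function.uncurry_def]
      have : Continuous (fun p : ℝ × ℝ => gaussD p.2 σ p.1) := by unfold gaussD; fun_prop
      fun_prop
    · refine Filter.Eventually.of_forall fun z => ?_
      simp only [Function.uncurry_def]
      rw [Real.norm_eq_abs, abs_mul, mul_comm]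
      exact mul_le_mul_of_nonneg_left (gauss_le _ _ _ hσ) (abs_nonneg _)

lemma pointwise (V : Measure ℝ) [IsProbabilityMeasure V] (c σ r : ℝ) (hσ : 0 < σ) (hr : 0 < r)
    (hV : V (Set.Icc (c - r) (c + r))ᶜ = 0) (l : ℕ) (x : ℝ) :
    |(∫ u, gaussD u σ x ∂V) - ∑ j ∈ Finset.range l, ip (fun x => ∫ u, gaussD u σ x ∂V) (psiH j c σ) * psiH j c σ x| ≤
     (1 / (Real.sqrt (2 * Real.pi) * σ)) * ∑' j, bco (j + l) (r / σ) * |psiH (j + l) 0 1 ((x - c) / σ)| := by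
  set κ := 1 / (Real.sqrt (2 * Real.pi) * σ) with hκ
  have hκ0 : 0 ≤ κ := by positivity
  set y := (x - c) / σ with hy
  have hVae : ∀ᵐ u ∂V, u ∈ Set.Icc (c - r) (c + r) := hV
  have hAint : ∀ j, Integrable (fun u => Aco j ((u - c) / σ)) V := by
    intro j
    refine (integrable_const (bco j (r / σ))).mono' ((Aco_cont j).comp (by fun_prop)).aestronglyMeasurable ?_
    filter_upwards [hVae] with u hu
    apply Aco_le
    rw [abs_div, abs_of_pos hσ]
    gcongr
    rw [abs_le]; constructor <;> linarith [hu.1, hu.2]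
  have hGint : Integrable (fun u => gaussD u σ x) V :=
    (integrable_const κ).mono' (gauss_cont σ x).aestronglyMeasurable
      (Filter.Eventually.of_forall fun u => gauss_le u σ x hσ)
  have e1 : (∫ u, gaussD u σ x ∂V) - ∑ j ∈ Finset.range l, ip (fun x => ∫ u, gaussD u σ x ∂V) (psiH j c σ) * psiH j c σ x =
      ∫ u, (gaussD u σ x - ∑ j ∈ Finset.range l, κ * Real.sqrt σ * Aco j ((u - c) / σ) * psiH j c σ x) ∂V := by
    rw [integral_sub hGint, integral_finsetSum]
    · congr 1
      refine Finset.sum_congr rfl fun j _ => ?_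
      rw [ip_eq V j c σ hσ, integral_mul_const]
    · intro j _
      exact ((hAint j).const_mul _).mul_const _
    · exact integrable_finsetSum _ fun j _ => ((hAint j).const_mul _).mul_const _
  rw [e1]
  have hb : ∀ᵐ u ∂V, ‖gaussD u σ x - ∑ j ∈ Finset.range l, κ * Real.sqrt σ * Aco j ((u - c) / σ) * psiH j c σ x‖ ≤
      κ * ∑' j, bco (j + l) (r / σ) * |psiH (j + l) 0 1 y| := by
    filter_upwards [hVae] with u hu
    set t := (u - c) / σ with ht
    have htr : |t| ≤ r / σ := by
      rw [ht, abs_div, abs_of_pos hσ]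
      gcongr
      rw [abs_le]; constructor <;> linarith [hu.1, hu.2]
    have hE := expand t y
    have e2 : gaussD u σ x - ∑ j ∈ Finset.range l, κ * Real.sqrt σ * Aco j t * psiH j c σ x =
        κ * ∑' j, Aco (j + l) t * psiH (j + l) 0 1 y := by
      have h1 := hE.summable.sum_add_tsum_nat_add l
      rw [hE.tsum_eq] at h1
      rw [gauss_eq u c σ x hσ, ← hκ, ← hy, ← ht, ← h1, mul_add, Finset.mul_sum]
      have : ∀ j ∈ Finset.range l, κ * Real.sqrt σ * Aco j t * psiH j c σ x = κ * (Aco j t * psiH j 0 1 y) := by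
        intro j _
        rw [psi_scale j c σ x hσ, ← hy]
        have h2 := Real.sqrt_pos.2 hσ
        field_simp
      rw [Finset.sum_congr rfl this]; ring
    rw [e2, norm_mul, Real.norm_of_nonneg hκ0]
    refine mul_le_mul_of_nonneg_left ?_ hκ0
    have hs : Summable (fun j => bco (j + l) (r / σ) * |psiH (j + l) 0 1 y|) :=
      (summable_nat_add_iff l).2 (bsummable (r / σ) y (by positivity))
    refine tsum_of_norm_bounded hs.hasSum fun j => ?_
    rw [Real.norm_eq_abs, abs_mul]
    exact mul_le_mul_of_nonneg_right (Aco_le _ _ _ htr) (abs_nonneg _)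
  have := norm_integral_le_of_norm_le_const hb
  simpa using this

/-- Lemma 17. If the estimated Hermite coefficients `λ̂_{i,j}` are within
`Δ` of the true coefficients `λ_{i,j} = w_i ⟨f_i, ψ_{j,c_i,σ}⟩`, then the truncated Hermite
reconstruction `f̃_i` approximates `w_i f_i` in `L¹` with the stated bound. -/
theorem stmt7 :
    ∃ cψ > (0 : ℝ),
      (∀ j : ℕ, 1 ≤ j →
        l1norm (psiH (j - 1) 0 1) ≤
          (2 : ℝ) ^ ((17 : ℝ) / 4) * cψ / (Real.Gamma (1 / 4)) ^ 2 * (j : ℝ) ^ ((1 : ℝ) / 4)) ∧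
      ∀ (σ cᵢ rᵢ wᵢ : ℝ), 0 < σ → 0 < rᵢ → 0 < wᵢ → wᵢ ≤ 1 →
        ∀ (V : Measure ℝ), IsProbabilityMeasure V →
          V (Set.Icc (cᵢ - rᵢ) (cᵢ + rᵢ))ᶜ = 0 →
          ∀ (Δ : ℝ), 0 < Δ → ∀ ℓ : ℕ,
            Nat.floor (2 * Real.exp 1 * rᵢ ^ 2 / σ ^ 2) + 1 ≤ ℓ →
            ∀ lamh : ℕ → ℝ,
              (∀ j : ℕ, j < ℓ →
                |wᵢ * ip (fun x => ∫ u, gaussD u σ x ∂V) (psiH j cᵢ σ) - lamh j| < Δ) →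
              l1norm (fun x =>
                  wᵢ * (∫ u, gaussD u σ x ∂V) -
                    ∑ j ∈ Finset.range ℓ, lamh j * psiH j cᵢ σ x) ≤
                (2 : ℝ) ^ ((17 : ℝ) / 4) * cψ * Real.sqrt σ / (Real.Gamma (1 / 4)) ^ 2 *
                    Δ * (ℓ : ℝ) ^ ((5 : ℝ) / 4)
                  + (2 : ℝ) ^ ((17 : ℝ) / 4) * cψ * rᵢ * wᵢ /
                      ((Real.Gamma (1 / 4)) ^ 2 * Real.pi ^ ((1 : ℝ) / 4) * σ) *
                    (1 / 2 : ℝ) ^ ℓ := by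

  set G := (Real.Gamma (1 / 4)) ^ 2 with hG
  have hG0 : 0 < G := by
    have : 0 < Real.Gamma (1 / 4) := Real.Gamma_pos_of_pos (by norm_num)
    positivity
  set T := (2 : ℝ) ^ ((17 : ℝ) / 4) with hT
  have hT0 : 0 < T := Real.rpow_pos_of_pos (by norm_num) _
  have hTG : T * (200 * G / T) = 200 * G := by field_simp
  refine ⟨200 * G / T, by positivity, ?_, ?_⟩
  · intro j hj
    obtain ⟨m, rfl⟩ : ∃ m, j = m + 1 := ⟨j - 1, by omega⟩
    rw [hTG, Nat.add_sub_cancel]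
    have h1 : 200 * G / G = 200 := by field_simp
    rw [h1]
    refine (phi_l1 m).trans ?_
    push_cast
    have : 0 ≤ ((m:ℝ) + 1) ^ ((1:ℝ)/4) := by positivity
    linarith
  · intro σ c r w hσ hr hw hw1 V hVp hV Δ hΔ l hl lamh hlam
    have hl1 : 1 ≤ l := by omega
    have hρ : 0 < r / σ := by positivity
    have hle : 2 * Real.exp 1 * (r / σ) ^ 2 ≤ l := by
      have h1 := Nat.lt_floor_add_one (2 * Real.exp 1 * r ^ 2 / σ ^ 2)
      have h2 : ((Nat.floor (2 * Real.exp 1 * r ^ 2 / σ ^ 2) : ℝ) + 1) ≤ l := by exact_mod_cast hl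
      have h3 : 2 * Real.exp 1 * (r / σ) ^ 2 = 2 * Real.exp 1 * r ^ 2 / σ ^ 2 := by
        rw [div_pow]; ring
      rw [h3]; linarith
    obtain ⟨hBi, hBv⟩ := tail_int l (r / σ) hρ hl1 hle
    set B := fun y => ∑' j, bco (j + l) (r / σ) * |psiH (j + l) 0 1 y| with hB
    set κ := 1 / (Real.sqrt (2 * Real.pi) * σ) with hκ
    have hκ0 : 0 ≤ κ := by positivity
    have hi1 : Integrable (fun x => ∑ j ∈ Finset.range l, Δ * |psiH j c σ x|) :=
      integrable_finsetSum _ fun j _ => (psi_int j c σ hσ).abs.const_mul _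
    have hi2 : Integrable (fun x => (w * κ) * B ((x - c) / σ)) :=
      (int_scale' B c σ hσ hBi).const_mul _
    have hmain : l1norm (fun x => w * (∫ u, gaussD u σ x ∂V) - ∑ j ∈ Finset.range l, lamh j * psiH j c σ x) ≤
        ∫ x, ((∑ j ∈ Finset.range l, Δ * |psiH j c σ x|) + (w * κ) * B ((x - c) / σ)) := by
      unfold l1norm
      refine integral_mono_of_nonneg (Filter.Eventually.of_forall fun x => abs_nonneg _) (hi1.add hi2)
        (Filter.Eventually.of_forall fun x => ?_)
      have hp := pointwise V c σ r hσ hr hV l x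
      simp only
      set f := fun x => ∫ u, gaussD u σ x ∂V with hf
      have e : w * (∫ u, gaussD u σ x ∂V) - ∑ j ∈ Finset.range l, lamh j * psiH j c σ x =
          (∑ j ∈ Finset.range l, (w * ip f (psiH j c σ) - lamh j) * psiH j c σ x) +
          w * ((∫ u, gaussD u σ x ∂V) - ∑ j ∈ Finset.range l, ip f (psiH j c σ) * psiH j c σ x) := by
        rw [mul_sub, Finset.mul_sum]
        simp_rw [sub_mul]
        rw [Finset.sum_sub_distrib]
        simp_rw [mul_assoc]
        ring
      rw [e]
      refine (abs_add_le _ _).trans (add_le_add ?_ ?_)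
      · refine (Finset.abs_sum_le_sum_abs _ _).trans (Finset.sum_le_sum fun j hj => ?_)
        rw [abs_mul]
        exact mul_le_mul_of_nonneg_right (hlam j (Finset.mem_range.1 hj)).le (abs_nonneg _)
      · rw [abs_mul, abs_of_pos hw, mul_assoc]
        exact mul_le_mul_of_nonneg_left hp hw.le
    refine hmain.trans ?_
    rw [integral_add hi1 hi2]
    refine add_le_add ?_ ?_
    · rw [integral_finsetSum _ (fun j _ => (psi_int j c σ hσ).abs.const_mul _)]
      have hl0 : (0:ℝ) < l := by exact_mod_cast hl1
      have hterm : ∀ j ∈ Finset.range l, ∫ x, Δ * |psiH j c σ x| ≤ Δ * (Real.sqrt σ * (4 * (l:ℝ) ^ ((1:ℝ)/4))) := by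
        intro j hj
        rw [integral_const_mul, psi_l1 j c σ hσ]
        have hjl : (j:ℝ) + 1 ≤ l := by exact_mod_cast Finset.mem_range.1 hj
        have h1 := phi_l1 j
        have h2 : ((j:ℝ) + 1) ^ ((1:ℝ)/4) ≤ (l:ℝ) ^ ((1:ℝ)/4) :=
          Real.rpow_le_rpow (by positivity) hjl (by norm_num)
        have h3 : l1norm (psiH j 0 1) ≤ 4 * (l:ℝ) ^ ((1:ℝ)/4) := by linarith
        gcongr
      refine (Finset.sum_le_sum hterm).trans ?_
      rw [Finset.sum_const, Finset.card_range, nsmul_eq_mul, hTG]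
      have h5 : (l:ℝ) ^ ((5:ℝ)/4) = l * (l:ℝ) ^ ((1:ℝ)/4) := by
        rw [show ((5:ℝ)/4) = 1 + 1/4 by norm_num, Real.rpow_add hl0, Real.rpow_one]
      rw [h5]
      have h6 : 200 * G * Real.sqrt σ / G = 200 * Real.sqrt σ := by field_simp
      rw [h6]
      have h7 : 0 ≤ Real.sqrt σ * Δ * (l * (l:ℝ) ^ ((1:ℝ)/4)) := by positivity
      nlinarith
    · rw [integral_const_mul, int_scale B c σ hσ, hTG]
      have hpi : Real.pi ^ ((1:ℝ)/4) ≤ 2 := by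
        have h1 : Real.pi ^ ((1:ℝ)/4) ≤ (4:ℝ) ^ ((1:ℝ)/2) :=
          (Real.rpow_le_rpow_of_exponent_le (by linarith [Real.pi_gt_three]) (by norm_num)).trans
            (Real.rpow_le_rpow Real.pi_pos.le Real.pi_le_four (by norm_num))
        rw [← Real.sqrt_eq_rpow, show (4:ℝ) = 2 ^ 2 by norm_num, Real.sqrt_sq (by norm_num)] at h1
        norm_num at h1 ⊢
        exact h1
      have hpi0 : 0 < Real.pi ^ ((1:ℝ)/4) := Real.rpow_pos_of_pos Real.pi_pos _
      have hκσ : κ * σ ≤ 1 := by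
        have : 1 ≤ Real.sqrt (2 * Real.pi) := Real.one_le_sqrt.2 (by linarith [Real.pi_gt_three])
        have h2 : κ * σ = 1 / Real.sqrt (2 * Real.pi) := by
          rw [hκ]; field_simp
        rw [h2, div_le_one (by linarith)]; exact this
      have hR : 200 * G * r * w / (G * Real.pi ^ ((1:ℝ)/4) * σ) * (1/2) ^ l =
          (200 / Real.pi ^ ((1:ℝ)/4)) * (w * (r / σ) * (1/2) ^ l) := by
        field_simp
      rw [hR]
      have h100 : 100 ≤ 200 / Real.pi ^ ((1:ℝ)/4) := by
        rw [le_div_iff₀ hpi0]; linarith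
      have hq : 0 ≤ w * (r / σ) * (1/2) ^ l := by positivity
      calc w * κ * (σ * ∫ y, B y) ≤ w * κ * (σ * (80 * (r / σ) * (1/2) ^ l)) := by gcongr
        _ = (κ * σ) * (80 * (w * (r / σ) * (1/2) ^ l)) := by ring
        _ ≤ 1 * (80 * (w * (r / σ) * (1/2) ^ l)) := by gcongr
        _ ≤ _ := by nlinarith
end
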